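/- arXiv:1610.01134 — 7 statements merged into one kernel-verified Lean document; each statement's English description precedes it below -/
import Mathlib

section
/- Let R be an ℝ-algebra with a star operation making it a star ring, with star ℝ-linear. Assume R is nicely normed in the sense that for every a : R there exists r : ℝ with a + star a = r • 1, and for every a : R one has a·star a = star a·a. Define on R × R the Cayley–Dickson multiplication (a,b)·(c,d) := (a·c − d·star b, star a·d + c·b) and conjugation conj(a,b) := (star a, −b). Then for every x : R × R there exists r : ℝ with x + conj(x) = r • (1,0), and x·conj(x) = conj(x)·x. -/
/-- The Cayley–Dickson doubling multiplication on `R × R`. -/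
def cdMul {R : Type*} [Ring R] [StarRing R] (x y : R × R) : R × R :=
  (x.1 * y.1 - y.2 * star x.2, star x.1 * y.2 + y.1 * x.2)

/-- The Cayley–Dickson conjugation on `R × R`. -/
def cdConj {R : Type*} [Ring R] [StarRing R] (x : R × R) : R × R :=
  (star x.1, -x.2)

/-- If a star `ℝ`-algebra `R` is nicely normed (i.e. `a + a*` is a real multiple of `1`
and `a · a* = a* · a` for all `a`), then so is its Cayley–Dickson double `R × R`. -/
theorem cayleyDickson_nicely_normed {R : Type*} [Ring R] [Algebra ℝ R]
    [StarRing R] [StarModule ℝ R]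
    (real_part : ∀ a : R, ∃ r : ℝ, a + star a = r • (1 : R))
    (norm_comm : ∀ a : R, a * star a = star a * a) :
    ∀ x : R × R,
      (∃ r : ℝ, x + cdConj x = r • (((1 : R), (0 : R)) : R × R)) ∧
      cdMul x (cdConj x) = cdMul (cdConj x) x := by
  rintro ⟨a, b⟩
  refine ⟨?_, ?_⟩
  · obtain ⟨r, hr⟩ := real_part a
    exact ⟨r, by simp [cdConj, hr]⟩
  · simp [cdMul, cdConj, norm_comm a]
end

section
/- Let ℍ denote the quaternions over ℝ (Mathlib's Quaternion ℝ), with conjugation star and norm ‖·‖. For all a, b, c, d : ℍ, the Cayley–Dickson product satisfies the norm composition identity ‖a·c − d·star b‖² + ‖star a·d + c·b‖² = (‖a‖² + ‖b‖²)·(‖c‖² + ‖d‖²). -/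
open Quaternion

/-- The Cayley–Dickson product on pairs of quaternions satisfies the norm
composition identity (the octonions form a normed algebra). -/
theorem cayleyDickson_norm_identity (a b c d : Quaternion ℝ) :
    ‖a * c - d * star b‖ ^ 2 + ‖star a * d + c * b‖ ^ 2 =
      (‖a‖ ^ 2 + ‖b‖ ^ 2) * (‖c‖ ^ 2 + ‖d‖ ^ 2) := by
  simp only [sq ‖_‖, ← normSq_eq_norm_mul_self, normSq_def', re_add, imI_add, imJ_add, imK_add,
    re_sub, imI_sub, imJ_sub, imK_sub, re_mul, imI_mul, imJ_mul, imK_mul,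
    re_star, imI_star, imJ_star, imK_star]
  ring
end

section
/- Let ℍ denote the quaternions over ℝ (Mathlib's Quaternion ℝ), with conjugation star and norm ‖·‖, and let p(a,b) := (2 • (a · star b), ‖a‖² − ‖b‖²) be the quaternionic Hopf map. Then p restricted to S⁷ is surjective onto S⁴: for every (q,t) : ℍ × ℝ with ‖q‖² + t² = 1 there exist a, b : ℍ with ‖a‖² + ‖b‖² = 1, 2 • (a · star b) = q, and ‖a‖² − ‖b‖² = t. -/
open Quaternion

/-- The quaternionic Hopf map `p (a, b) := (2 • (a · star b), ‖a‖² − ‖b‖²)`,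
restricted to `S⁷`, is surjective onto `S⁴`. -/
theorem quaternionicHopf_surjective (q : Quaternion ℝ) (t : ℝ)
    (h : ‖q‖ ^ 2 + t ^ 2 = 1) :
    ∃ a b : Quaternion ℝ, ‖a‖ ^ 2 + ‖b‖ ^ 2 = 1 ∧
      2 • (a * star b) = q ∧ ‖a‖ ^ 2 - ‖b‖ ^ 2 = t := by
  have hq := sq_nonneg ‖q‖
  rcases eq_or_ne t (-1) with rfl | ht
  · have hq0 : q = 0 := norm_eq_zero.mp (pow_eq_zero_iff two_ne_zero |>.mp (by linarith))
    exact ⟨0, 1, by simp [hq0]⟩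
  · have ht_lower : -1 < t := lt_of_le_of_ne (by nlinarith) ht.symm
    obtain ⟨s, hs, hs_sq⟩ : ∃ s : ℝ, 0 < s ∧ s ^ 2 = (1 + t) / 2 :=
      ⟨√((1 + t) / 2), Real.sqrt_pos.mpr (by linarith), Real.sq_sqrt (by linarith)⟩
    have ha : ‖(s : Quaternion ℝ)‖ ^ 2 = (1 + t) / 2 := by
      rw [Quaternion.norm_coe, Real.norm_eq_abs, sq_abs, hs_sq]
    have hb : ‖(2 * s)⁻¹ • star q‖ ^ 2 = (1 - t) / 2 := by
      rw [norm_smul, norm_star, mul_pow, Real.norm_eq_abs, sq_abs, inv_pow, mul_pow, hs_sq,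
        show ‖q‖ ^ 2 = (1 - t) * (1 + t) by linarith]
      have : 1 + t ≠ 0 := by linarith
      field_simp
    refine ⟨s, (2 * s)⁻¹ • star q, by rw [ha, hb]; ring, ?_, by rw [ha, hb]; ring⟩
    rw [Quaternion.coe_mul_eq_smul, Quaternion.star_smul, star_star, smul_smul, two_smul,
      ← add_smul, show s * (2 * s)⁻¹ + s * (2 * s)⁻¹ = 1 by field_simp; norm_num, one_smul]
end

section
/- Let ℍ denote the quaternions over ℝ (Mathlib's Quaternion ℝ), with conjugation star and norm ‖·‖, and let p(a,b) := (2 • (a · star b), ‖a‖² − ‖b‖²) be the quaternionic Hopf map. For all (a,b), (c,d) : ℍ × ℍ with ‖a‖² + ‖b‖² = 1 and ‖c‖² + ‖d‖² = 1, one has p(a,b) = p(c,d) if and only if there exists u : ℍ with ‖u‖ = 1, c = a·u, and d = b·u. In other words, the fibers of p on S⁷ are exactly the orbits of the right action of the group of unit quaternions. -/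
open Quaternion

/-- Two points of `S⁷` have the same image under the quaternionic Hopf map
`p (a, b) := (2 • (a · star b), ‖a‖² − ‖b‖²)` if and only if they lie in the
same orbit of the right action of the group of unit quaternions. -/
theorem quaternionicHopf_fiber_eq_orbit (a b c d : Quaternion ℝ)
    (hab : ‖a‖ ^ 2 + ‖b‖ ^ 2 = 1) (hcd : ‖c‖ ^ 2 + ‖d‖ ^ 2 = 1) :
    ((2 • (a * star b), ‖a‖ ^ 2 - ‖b‖ ^ 2) : Quaternion ℝ × ℝ) =
        (2 • (c * star d), ‖c‖ ^ 2 - ‖d‖ ^ 2) ↔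
      ∃ u : Quaternion ℝ, ‖u‖ = 1 ∧ c = a * u ∧ d = b * u := by
  constructor
  · intro h
    obtain ⟨hmul, hsub⟩ := Prod.ext_iff.1 h
    have hac : ‖a‖ ^ 2 = ‖c‖ ^ 2 := by dsimp only at hsub; linarith
    have hbd : ‖b‖ ^ 2 = ‖d‖ ^ 2 := by linarith
    have hcross : a * star b = c * star d := by
      refine smul_right_injective _ (two_ne_zero (α := ℝ)) ?_
      simpa only [two_smul] using hmul
    have hcross' : b * star a = d * star c := by simpa using congrArg star hcross
    have hc : a * (star a * c + star b * d) = c := by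
      rw [mul_add, ← mul_assoc, ← mul_assoc, hcross, mul_assoc c, self_mul_star, star_mul_self,
        coe_mul_eq_smul, mul_coe_eq_smul, ← add_smul, normSq_eq_norm_mul_self,
        normSq_eq_norm_mul_self, ← sq, ← sq, ← hbd, hab, one_smul]
    have hd : b * (star a * c + star b * d) = d := by
      rw [mul_add, ← mul_assoc, ← mul_assoc, hcross', mul_assoc d, self_mul_star, star_mul_self,
        coe_mul_eq_smul, mul_coe_eq_smul, ← add_smul, normSq_eq_norm_mul_self,
        normSq_eq_norm_mul_self, ← sq, ← sq, ← hac, hab, one_smul]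
    refine ⟨star a * c + star b * d, ?_, hc.symm, hd.symm⟩
    set u := star a * c + star b * d
    have hu : ‖u‖ ^ 2 = 1 := by
      rw [← hc, ← hd, norm_mul, norm_mul, mul_pow, mul_pow, ← add_mul, hab, one_mul] at hcd
      exact hcd
    exact (pow_eq_one_iff_of_nonneg (norm_nonneg u) two_ne_zero).1 hu
  · rintro ⟨u, hu, rfl, rfl⟩
    have huu : u * star u = 1 := by simp [self_mul_star, normSq_eq_norm_mul_self, hu]
    rw [star_mul, mul_assoc a, ← mul_assoc u, huu, one_mul, norm_mul, norm_mul, hu, mul_one,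
      mul_one]
end

section
/- Let ℍ denote the quaternions over ℝ (Mathlib's Quaternion ℝ), with conjugation star and norm ‖·‖, and let p(a,b) := (2 • (a · star b), ‖a‖² − ‖b‖²) be the quaternionic Hopf map, restricted to a map from S⁷ = {(a,b) : ℍ × ℍ | ‖a‖² + ‖b‖² = 1} to S⁴ = {(q,t) : ℍ × ℝ | ‖q‖² + t² = 1} (both with subspace topologies). Then for every point y of S⁴, the fiber p⁻¹(y) (with its subspace topology) is homeomorphic to the unit sphere of ℍ, i.e., to S³ = {u : ℍ | ‖u‖ = 1}. -/
open Quaternion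

theorem Quaternion.star_mul_self_eq_coe_norm_sq (a : Quaternion ℝ) :
    star a * a = ((‖a‖ ^ 2 : ℝ) : Quaternion ℝ) := by
  rw [Quaternion.star_mul_self, Quaternion.normSq_eq_norm_mul_self, sq]

theorem Quaternion.self_mul_star_eq_coe_norm_sq (a : Quaternion ℝ) :
    a * star a = ((‖a‖ ^ 2 : ℝ) : Quaternion ℝ) := by
  rw [Quaternion.self_mul_star, Quaternion.normSq_eq_norm_mul_self, sq]

/-- The quaternionic Hopf map is surjective onto `S⁴`. -/
theorem exists_quaternionicHopf_eq (q : Quaternion ℝ) (t : ℝ) (hy : ‖q‖ ^ 2 + t ^ 2 = 1) :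
    ∃ a b : Quaternion ℝ, ‖a‖ ^ 2 + ‖b‖ ^ 2 = 1 ∧ 2 • (a * star b) = q ∧
      ‖a‖ ^ 2 - ‖b‖ ^ 2 = t := by
  by_cases ht : t = -1
  · subst ht
    have hq : q = 0 := by
      rw [← norm_eq_zero, ← sq_eq_zero_iff]
      linarith
    exact ⟨0, 1, by simp, by simp [hq], by simp⟩
  · have ht' : 0 < 1 + t := by
      have h1 : -1 ≤ t := by nlinarith [sq_nonneg ‖q‖]
      have h2 : -1 < t := lt_of_le_of_ne h1 (Ne.symm ht)
      linarith
    obtain ⟨r, hr0, hr⟩ : ∃ r : ℝ, 0 < r ∧ r ^ 2 = (1 + t) / 2 :=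
      ⟨√((1 + t) / 2), by positivity, Real.sq_sqrt (by positivity)⟩
    have ha : ‖(r : Quaternion ℝ)‖ ^ 2 = (1 + t) / 2 := by
      rw [Quaternion.norm_coe, Real.norm_eq_abs, sq_abs, hr]
    have hb : ‖(2 * r)⁻¹ • star q‖ ^ 2 = (1 - t) / 2 := by
      rw [norm_smul, norm_star, mul_pow, Real.norm_eq_abs, sq_abs, inv_pow, mul_pow, hr]
      field_simp
      linarith
    refine ⟨r, (2 * r)⁻¹ • star q, by rw [ha, hb]; ring, ?_, by rw [ha, hb]; ring⟩
    rw [Quaternion.star_smul, star_star, Quaternion.coe_mul_eq_smul, smul_smul,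
      ← Nat.cast_smul_eq_nsmul ℝ, smul_smul]
    convert one_smul ℝ q
    push_cast
    field_simp

/-- Two points of `S⁷` in the same fiber of the quaternionic Hopf map differ by right
multiplication by the quaternion `star a₀ * a + star b₀ * b`. -/
theorem mul_star_mul_add_of_mul_star_eq {a b a₀ b₀ : Quaternion ℝ}
    (h : a * star b = a₀ * star b₀) (ha : ‖a‖ ^ 2 = ‖a₀‖ ^ 2) (hab : ‖a‖ ^ 2 + ‖b‖ ^ 2 = 1) :
    a₀ * (star a₀ * a + star b₀ * b) = a := by
  rw [mul_add, ← mul_assoc, ← mul_assoc, ← h, mul_assoc a,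
    Quaternion.self_mul_star_eq_coe_norm_sq, Quaternion.star_mul_self_eq_coe_norm_sq,
    ← ha, Quaternion.coe_commutes, ← mul_add, ← Quaternion.coe_add, hab,
    Quaternion.coe_one, mul_one]

/-- Every fiber of the quaternionic Hopf map `p : S⁷ → S⁴`,
`p (a, b) := (2 • (a · star b), ‖a‖² − ‖b‖²)`, with its subspace topology,
is homeomorphic to the unit sphere `S³ = {u : ℍ | ‖u‖ = 1}`. -/
theorem quaternionicHopf_fiber_homeo (q : Quaternion ℝ) (t : ℝ)
    (hy : ‖q‖ ^ 2 + t ^ 2 = 1) :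
    Nonempty
      (({x : {z : Quaternion ℝ × Quaternion ℝ // ‖z.1‖ ^ 2 + ‖z.2‖ ^ 2 = 1} //
          2 • (x.1.1 * star x.1.2) = q ∧ ‖x.1.1‖ ^ 2 - ‖x.1.2‖ ^ 2 = t} ≃ₜ
        {u : Quaternion ℝ // ‖u‖ = 1})) := by
  obtain ⟨a₀, b₀, h₀, hq₀, ht₀⟩ := exists_quaternionicHopf_eq q t hy
  have key : ∀ a b : Quaternion ℝ, ‖a‖ ^ 2 + ‖b‖ ^ 2 = 1 → 2 • (a * star b) = q →
      ‖a‖ ^ 2 - ‖b‖ ^ 2 = t →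
      a₀ * (star a₀ * a + star b₀ * b) = a ∧ b₀ * (star a₀ * a + star b₀ * b) = b := by
    intro a b h hq ht
    have hm : a * star b = a₀ * star b₀ := by
      have h2 := hq.trans hq₀.symm
      rw [← Nat.cast_smul_eq_nsmul ℝ, ← Nat.cast_smul_eq_nsmul ℝ] at h2
      exact smul_right_injective (Quaternion ℝ) (by norm_num : ((2 : ℕ) : ℝ) ≠ 0) h2
    have hm' : b * star a = b₀ * star a₀ := by simpa using congrArg star hm
    refine ⟨mul_star_mul_add_of_mul_star_eq hm (by linarith) h, ?_⟩
    rw [add_comm]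
    exact mul_star_mul_add_of_mul_star_eq hm' (by linarith) (by linarith)
  refine ⟨{
    toFun := fun x => ⟨star a₀ * x.1.1.1 + star b₀ * x.1.1.2, ?_⟩
    invFun := fun u => ⟨⟨(a₀ * u.1, b₀ * u.1), ?_⟩, ?_, ?_⟩
    left_inv := ?_
    right_inv := ?_
    continuous_toFun := ?_
    continuous_invFun := ?_ }⟩
  · obtain ⟨⟨⟨a, b⟩, h⟩, hq, ht⟩ := x
    obtain ⟨h1, h2⟩ := key a b h hq ht
    have h3 := h
    dsimp only at h3 ⊢
    rw [← congrArg norm h1, ← congrArg norm h2, norm_mul, norm_mul, mul_pow, mul_pow,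
      ← add_mul, h₀, one_mul] at h3
    exact (pow_eq_one_iff_of_nonneg (norm_nonneg _) two_ne_zero).1 h3
  · simpa [u.2] using h₀
  · have hu : u.1 * star u.1 = 1 := by
      rw [Quaternion.self_mul_star_eq_coe_norm_sq, u.2, one_pow, Quaternion.coe_one]
    dsimp only
    rw [star_mul, mul_assoc, ← mul_assoc u.1, hu, one_mul, hq₀]
  · simpa [u.2] using ht₀
  · rintro ⟨⟨⟨a, b⟩, h⟩, hq, ht⟩
    obtain ⟨h1, h2⟩ := key a b h hq ht
    exact Subtype.ext (Subtype.ext (Prod.ext h1 h2))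
  · rintro ⟨u, hu⟩
    refine Subtype.ext ?_
    dsimp only
    rw [← mul_assoc, ← mul_assoc, ← add_mul, Quaternion.star_mul_self_eq_coe_norm_sq,
      Quaternion.star_mul_self_eq_coe_norm_sq, ← Quaternion.coe_add, h₀, Quaternion.coe_one,
      one_mul]
  · exact Continuous.subtype_mk (by fun_prop) _
  · exact Continuous.subtype_mk (Continuous.subtype_mk (by fun_prop) _) _
end

section
/- Let ℍ denote the quaternions over ℝ (Mathlib's Quaternion ℝ), with conjugation star and norm ‖·‖, and let p : S⁷ → S⁴ be the restriction of the quaternionic Hopf map p(a,b) := (2 • (a · star b), ‖a‖² − ‖b‖²), where S⁷ = {(a,b) : ℍ × ℍ | ‖a‖² + ‖b‖² = 1} and S⁴ = {(q,t) : ℍ × ℝ | ‖q‖² + t² = 1} carry the subspace topologies. Then p is a locally trivial fiber bundle with fiber S³ = {u : ℍ | ‖u‖ = 1}: p is continuous, and for every y ∈ S⁴ there exist an open neighborhood U of y in S⁴ and a homeomorphism φ : p⁻¹(U) ≃ U × S³ such that the first projection of φ(x) equals p(x) for all x ∈ p⁻¹(U). -/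
open Quaternion

namespace QuaternionicHopf

/-- The unit sphere `S⁷` in `ℍ × ℍ`. -/
abbrev TotalSphere : Type :=
  {z : Quaternion ℝ × Quaternion ℝ // ‖z.1‖ ^ 2 + ‖z.2‖ ^ 2 = 1}

/-- The unit sphere `S⁴` in `ℍ × ℝ`. -/
abbrev BaseSphere : Type :=
  {w : Quaternion ℝ × ℝ // ‖w.1‖ ^ 2 + w.2 ^ 2 = 1}

/-- The unit sphere `S³` in `ℍ`. -/
abbrev UnitQuaternion : Type := {u : Quaternion ℝ // ‖u‖ = 1}

lemma mul_star_self_eq_coe (a : Quaternion ℝ) : a * star a = ((‖a‖ ^ 2 : ℝ) : Quaternion ℝ) := by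
  rw [Quaternion.self_mul_star, Quaternion.normSq_eq_norm_mul_self, sq]

lemma star_mul_self_eq_coe (a : Quaternion ℝ) : star a * a = ((‖a‖ ^ 2 : ℝ) : Quaternion ℝ) := by
  rw [Quaternion.star_mul_self, Quaternion.normSq_eq_norm_mul_self, sq]

/-- The quaternionic Hopf map `S⁷ → S⁴`. -/
noncomputable def hopf (x : TotalSphere) : BaseSphere :=
  ⟨(2 • (x.1.1 * star x.1.2), ‖x.1.1‖ ^ 2 - ‖x.1.2‖ ^ 2), by
    have h := x.2
    have h2 : ‖2 • (x.1.1 * star x.1.2)‖ = 2 * (‖x.1.1‖ * ‖x.1.2‖) := by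
      rw [← Nat.cast_smul_eq_nsmul ℝ, norm_smul, norm_mul, Quaternion.norm_star]
      norm_num
    simp only [h2]
    linear_combination (‖x.1.1‖ ^ 2 + ‖x.1.2‖ ^ 2 + 1) * h⟩

lemma continuous_hopf : Continuous hopf := by
  unfold hopf
  fun_prop

lemma hopf_eq_iff {x : TotalSphere} {y : BaseSphere} :
    hopf x = y ↔ 2 • (x.1.1 * star x.1.2) = y.1.1 ∧ ‖x.1.1‖ ^ 2 - ‖x.1.2‖ ^ 2 = y.1.2 := by
  rw [Subtype.ext_iff, Prod.ext_iff]
  rfl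

lemma hopf_eq_hopf {x y : TotalSphere} (h : hopf x = hopf y) :
    x.1.1 * star x.1.2 = y.1.1 * star y.1.2 ∧ ‖x.1.1‖ ^ 2 = ‖y.1.1‖ ^ 2 ∧
      ‖x.1.2‖ ^ 2 = ‖y.1.2‖ ^ 2 := by
  obtain ⟨h1, h2⟩ := hopf_eq_iff.1 h
  simp only [hopf] at h1 h2
  refine ⟨?_, by linarith [x.2, y.2], by linarith [x.2, y.2]⟩
  rw [← Nat.cast_smul_eq_nsmul ℝ, ← Nat.cast_smul_eq_nsmul ℝ] at h1
  exact smul_right_injective _ (by norm_num) h1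

/-- The right action of `S³` on `S⁷`. -/
noncomputable def act (x : TotalSphere) (u : UnitQuaternion) : TotalSphere :=
  ⟨(x.1.1 * u.1, x.1.2 * u.1), by simpa [norm_mul, u.2] using x.2⟩

lemma hopf_act (x : TotalSphere) (u : UnitQuaternion) : hopf (act x u) = hopf x := by
  have hu : u.1 * star u.1 = 1 := by rw [mul_star_self_eq_coe, u.2]; simp
  refine hopf_eq_iff.2 ⟨?_, by simp [act, hopf, norm_mul, u.2]⟩
  simp only [act, hopf, star_mul]
  rw [mul_assoc x.1.1, ← mul_assoc u.1, hu, one_mul]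

/-- The quaternionic Hermitian product on `ℍ × ℍ`. -/
noncomputable def herm (x y : Quaternion ℝ × Quaternion ℝ) : Quaternion ℝ := star x.1 * y.1 + star x.2 * y.2

lemma mul_herm {x y : TotalSphere} (h : hopf x = hopf y) :
    x.1.1 * herm x.1 y.1 = y.1.1 ∧ x.1.2 * herm x.1 y.1 = y.1.2 := by
  obtain ⟨h1, h2, h3⟩ := hopf_eq_hopf h
  have h1' : x.1.2 * star x.1.1 = y.1.2 * star y.1.1 := by simpa using congrArg star h1
  constructor
  · rw [herm, mul_add, ← mul_assoc, ← mul_assoc, h1, mul_star_self_eq_coe, mul_assoc,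
      star_mul_self_eq_coe, ← Quaternion.coe_commutes, ← add_mul, ← Quaternion.coe_add, h2, y.2]
    simp
  · rw [herm, mul_add, ← mul_assoc, ← mul_assoc, h1', mul_star_self_eq_coe, mul_assoc,
      star_mul_self_eq_coe, ← Quaternion.coe_commutes, ← add_mul, ← Quaternion.coe_add, h3, y.2]
    simp

lemma norm_herm {x y : TotalSphere} (h : hopf x = hopf y) : ‖herm x.1 y.1‖ = 1 := by
  obtain ⟨h1, h2⟩ := mul_herm h
  have hy := y.2
  rw [← h1, ← h2, norm_mul, norm_mul, mul_pow, mul_pow, ← add_mul, x.2, one_mul] at hy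
  exact (pow_eq_one_iff_of_nonneg (norm_nonneg _) two_ne_zero).1 hy

lemma herm_act (x : TotalSphere) (u : UnitQuaternion) : herm x.1 (act x u).1 = u.1 := by
  simp only [herm, act]
  rw [← mul_assoc, ← mul_assoc, ← add_mul, star_mul_self_eq_coe, star_mul_self_eq_coe,
    ← Quaternion.coe_add, x.2]
  simp

/-- The local trivialization of the Hopf map determined by a continuous local section. -/
noncomputable def trivializationOfSection {U : Set BaseSphere} (s : U → TotalSphere) (hs : Continuous s)
    (hsec : ∀ y, hopf (s y) = y) : (hopf ⁻¹' U) ≃ₜ U × UnitQuaternion where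
  toFun x := (⟨hopf x, x.2⟩, ⟨herm (s ⟨hopf x, x.2⟩).1 x.1.1, norm_herm (hsec _)⟩)
  invFun z := ⟨act (s z.1) z.2, by rw [Set.mem_preimage, hopf_act, hsec]; exact z.1.2⟩
  left_inv x := by
    obtain ⟨h1, h2⟩ := mul_herm (hsec ⟨hopf x, x.2⟩)
    exact Subtype.ext (Subtype.ext (Prod.ext h1 h2))
  right_inv z := by
    have h : (⟨hopf (act (s z.1) z.2), by rw [hopf_act, hsec]; exact z.1.2⟩ : U) = z.1 :=
      Subtype.ext ((hopf_act _ _).trans (hsec _))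
    refine Prod.ext h (Subtype.ext ?_)
    dsimp only
    rw [h, herm_act]
  continuous_toFun := by
    have hp : Continuous fun x : hopf ⁻¹' U => (⟨hopf x, x.2⟩ : U) :=
      (continuous_hopf.comp continuous_subtype_val).subtype_mk _
    have hsp := hs.comp hp
    refine hp.prodMk (Continuous.subtype_mk ?_ _)
    unfold herm
    simp only [Function.comp_def] at hsp
    fun_prop
  continuous_invFun := by
    unfold act
    fun_prop

lemma norm_sq_div_two_mul_sqrt {q : Quaternion ℝ} {t c : ℝ} (h : ‖q‖ ^ 2 + t ^ 2 = 1)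
    (hc : 0 < c) (hct : c ^ 2 = (1 + t) / 2) : ‖(2 * c)⁻¹ • q‖ ^ 2 = (1 - t) / 2 := by
  have hq : ‖q‖ ^ 2 = 4 * c ^ 2 * ((1 - t) / 2) := by rw [hct]; linarith
  rw [norm_smul, mul_pow, hq, Real.norm_eq_abs, sq_abs]
  field_simp
  ring

lemma two_nsmul_smul_inv (q : Quaternion ℝ) {c : ℝ} (hc : 0 < c) :
    2 • (c • (2 * c)⁻¹ • q) = q := by
  rw [← Nat.cast_smul_eq_nsmul ℝ, smul_smul, smul_smul,
    show ((2 : ℕ) : ℝ) * c * (2 * c)⁻¹ = 1 by push_cast; field_simp, one_smul]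

lemma sqrt_half_sq {t : ℝ} (ht : 0 < 1 + t) : √((1 + t) / 2) ^ 2 = (1 + t) / 2 :=
  Real.sq_sqrt (by linarith)

lemma sqrt_half_pos {t : ℝ} (ht : 0 < 1 + t) : 0 < √((1 + t) / 2) :=
  Real.sqrt_pos.2 (by linarith)

/-- Away from the pole `t = -1`, the Hopf map has a continuous section with real positive first
coordinate. -/
lemma exists_section_north : ∃ s : {y : BaseSphere | 0 < 1 + y.1.2} → TotalSphere,
    Continuous s ∧ ∀ y, hopf (s y) = y := by
  have key (y : {y : BaseSphere | 0 < 1 + y.1.2}) := norm_sq_div_two_mul_sqrt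
    (q := star y.1.1.1) (by rw [Quaternion.norm_star]; exact y.1.2)
    (sqrt_half_pos y.2) (sqrt_half_sq y.2)
  have hc : Continuous fun y : {y : BaseSphere | 0 < 1 + y.1.2} => (2 * √((1 + y.1.1.2) / 2))⁻¹ :=
    Continuous.inv₀ (by fun_prop) fun y => by have := sqrt_half_pos y.2; positivity
  have hn (y : {y : BaseSphere | 0 < 1 + y.1.2}) :
      ‖((√((1 + y.1.1.2) / 2) : ℝ) : Quaternion ℝ)‖ ^ 2 = (1 + y.1.1.2) / 2 := by
    rw [Quaternion.norm_coe, Real.norm_eq_abs, sq_abs, sqrt_half_sq y.2]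
  refine ⟨fun y => ⟨(((√((1 + y.1.1.2) / 2) : ℝ) : Quaternion ℝ),
    (2 * √((1 + y.1.1.2) / 2))⁻¹ • star y.1.1.1), ?_⟩, ?_, fun y => hopf_eq_iff.2 ⟨?_, ?_⟩⟩
  · simp only [hn, key]
    ring
  · refine Continuous.subtype_mk (Continuous.prodMk ?_ ?_) _
    · exact Quaternion.continuous_coe.comp (by fun_prop)
    · fun_prop
  · rw [Quaternion.star_smul, star_star, Quaternion.coe_mul_eq_smul]
    exact two_nsmul_smul_inv _ (sqrt_half_pos y.2)
  · simp only [hn, key]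
    ring

/-- Away from the pole `t = 1`, the Hopf map has a continuous section with real positive second
coordinate. -/
lemma exists_section_south : ∃ s : {y : BaseSphere | 0 < 1 + -y.1.2} → TotalSphere,
    Continuous s ∧ ∀ y, hopf (s y) = y := by
  have key (y : {y : BaseSphere | 0 < 1 + -y.1.2}) := norm_sq_div_two_mul_sqrt
    (q := y.1.1.1) (t := -y.1.1.2) (by rw [neg_sq]; exact y.1.2)
    (sqrt_half_pos y.2) (sqrt_half_sq y.2)
  have hc : Continuous fun y : {y : BaseSphere | 0 < 1 + -y.1.2} => (2 * √((1 + -y.1.1.2) / 2))⁻¹ :=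
    Continuous.inv₀ (by fun_prop) fun y => by have := sqrt_half_pos y.2; positivity
  have hn (y : {y : BaseSphere | 0 < 1 + -y.1.2}) :
      ‖((√((1 + -y.1.1.2) / 2) : ℝ) : Quaternion ℝ)‖ ^ 2 = (1 + -y.1.1.2) / 2 := by
    rw [Quaternion.norm_coe, Real.norm_eq_abs, sq_abs, sqrt_half_sq y.2]
  refine ⟨fun y => ⟨((2 * √((1 + -y.1.1.2) / 2))⁻¹ • y.1.1.1,
    ((√((1 + -y.1.1.2) / 2) : ℝ) : Quaternion ℝ)), ?_⟩, ?_, fun y => hopf_eq_iff.2 ⟨?_, ?_⟩⟩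
  · simp only [hn, key]
    ring
  · refine Continuous.subtype_mk (Continuous.prodMk ?_ ?_) _
    · fun_prop
    · exact Quaternion.continuous_coe.comp (by fun_prop)
  · rw [Quaternion.star_coe, Quaternion.mul_coe_eq_smul]
    exact two_nsmul_smul_inv _ (sqrt_half_pos y.2)
  · simp only [hn, key]
    ring

end QuaternionicHopf

/-- The quaternionic Hopf map `p : S⁷ → S⁴`,
`p (a, b) := (2 • (a · star b), ‖a‖² − ‖b‖²)`, is a locally trivial fiber
bundle with fiber `S³`: it is continuous, and every point of `S⁴` has an open
neighborhood `U` with a homeomorphism `p⁻¹(U) ≃ₜ U × S³` over `U`. -/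
theorem quaternionicHopf_isFiberBundle :
    ∃ p : {z : Quaternion ℝ × Quaternion ℝ // ‖z.1‖ ^ 2 + ‖z.2‖ ^ 2 = 1} →
        {w : Quaternion ℝ × ℝ // ‖w.1‖ ^ 2 + w.2 ^ 2 = 1},
      (∀ x, (p x : Quaternion ℝ × ℝ) =
          (2 • (x.1.1 * star x.1.2), ‖x.1.1‖ ^ 2 - ‖x.1.2‖ ^ 2)) ∧
      Continuous p ∧
      ∀ y : {w : Quaternion ℝ × ℝ // ‖w.1‖ ^ 2 + w.2 ^ 2 = 1},
        ∃ U : Set {w : Quaternion ℝ × ℝ // ‖w.1‖ ^ 2 + w.2 ^ 2 = 1},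
          IsOpen U ∧ y ∈ U ∧
          ∃ φ : (p ⁻¹' U) ≃ₜ U × {u : Quaternion ℝ // ‖u‖ = 1},
            ∀ x : p ⁻¹' U, ((φ x).1 : {w : Quaternion ℝ × ℝ // ‖w.1‖ ^ 2 + w.2 ^ 2 = 1}) =
              p x := by
  refine ⟨QuaternionicHopf.hopf, fun _ => rfl, QuaternionicHopf.continuous_hopf, fun y => ?_⟩
  by_cases hy : 0 < 1 + y.1.2
  · obtain ⟨s, hs, hsec⟩ := QuaternionicHopf.exists_section_north
    exact ⟨{y | 0 < 1 + y.1.2}, isOpen_lt continuous_const (by fun_prop), hy,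
      QuaternionicHopf.trivializationOfSection s hs hsec, fun _ => rfl⟩
  · obtain ⟨s, hs, hsec⟩ := QuaternionicHopf.exists_section_south
    have hy' : 0 < 1 + -y.1.2 := by linarith
    exact ⟨{y | 0 < 1 + -y.1.2}, isOpen_lt continuous_const (by fun_prop), hy',
      QuaternionicHopf.trivializationOfSection s hs hsec, fun _ => rfl⟩
end

section
/- Let S⁴ := Metric.sphere (0 : EuclideanSpace ℝ (Fin 5)) 1, the unit 4-sphere with the subspace topology, and let x₀ be any point of S⁴. Then the seventh homotopy group π₇(S⁴, x₀) contains an element of infinite order: there exists g in HomotopyGroup 7 S⁴ x₀ such that g is not of finite order (for every positive integer n, gⁿ ≠ 1). -/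
namespace KuhnDegree

open scoped Topology
open Finset Equiv

section Cochains

variable {A : Type*}

/-- The simplicial coboundary of a cochain, where cochains are functions on lists of vertices. -/
def coboundary : List A → (List A → ℤ) → ℤ
  | [], _ => 0
  | a :: l, φ => φ l - coboundary l fun m => φ (a :: m)

/-- The prism operator, turning a cochain on `A` into a cochain on `A × A` of one degree less. -/
def prism : List (A × A) → (List A → ℤ) → ℤ
  | [], _ => 0
  | p :: l, φ => φ (p.1 :: p.2 :: l.map Prod.snd) - prism l fun m => φ (p.1 :: m)

theorem coboundary_sub (l : List A) (φ ψ : List A → ℤ) :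
    coboundary l (fun m => φ m - ψ m) = coboundary l φ - coboundary l ψ := by
  induction l generalizing φ ψ with
  | nil => simp [coboundary]
  | cons a l ih => simp only [coboundary, ih]; ring

theorem prism_sub (l : List (A × A)) (φ ψ : List A → ℤ) :
    prism l (fun m => φ m - ψ m) = prism l φ - prism l ψ := by
  induction l generalizing φ ψ with
  | nil => simp [prism]
  | cons a l ih => simp only [prism, ih]; ring

theorem coboundary_map {B : Type*} (f : B → A) (l : List B) (φ : List A → ℤ) :
    coboundary (l.map f) φ = coboundary l fun m => φ (m.map f) := by
  induction l generalizing φ with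
  | nil => rfl
  | cons a l ih => simp only [coboundary, ih, List.map_cons]

/-- The prism operator is a chain homotopy between the two projections. -/
theorem prism_coboundary (l : List (A × A)) (φ : List A → ℤ) :
    prism l (fun m => coboundary m φ) + coboundary l (fun m => prism m φ) =
      φ (l.map Prod.snd) - φ (l.map Prod.fst) := by
  induction l generalizing φ with
  | nil => simp [prism, coboundary]
  | cons p l ih =>
    have h := ih fun m => φ (p.1 :: m)
    simp only [prism, coboundary, List.map_cons, prism_sub, coboundary_sub, coboundary_map] at h ⊢
    linarith

theorem prism_eq_zero (S : Set A) (l : List (A × A)) (φ : List A → ℤ)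
    (hl : ∀ p ∈ l, p.1 ∈ S ∧ p.2 ∈ S)
    (hφ : ∀ m : List A, m.length = l.length + 1 → (∀ a ∈ m, a ∈ S) → φ m = 0) :
    prism l φ = 0 := by
  induction l generalizing φ with
  | nil => rfl
  | cons p l ih =>
    have hp := hl p (by simp)
    rw [prism, hφ, ih, sub_zero]
    · exact fun q hq => hl q (by simp [hq])
    · intro m hm hS
      exact hφ _ (by simp [hm]) (by simpa [hp.1] using hS)
    · simp
    · simp only [List.mem_cons, List.mem_map]
      rintro a (rfl | rfl | ⟨q, hq, rfl⟩)
      · exact hp.1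
      · exact hp.2
      · exact (hl q (by simp [hq])).2

theorem coboundary_ofFn {k : ℕ} (c : Fin (k + 1) → A) (φ : List A → ℤ) :
    coboundary (List.ofFn c) φ =
      ∑ i : Fin (k + 1), (-1) ^ (i : ℕ) * φ (List.ofFn fun j => c (i.succAbove j)) := by
  induction k generalizing φ with
  | zero => simp [coboundary]
  | succ k ih =>
    rw [List.ofFn_succ, coboundary, ih, Fin.sum_univ_succ (n := k + 1)]
    have (i : Fin (k + 1)) : (List.ofFn fun j => c (i.succ.succAbove j)) =
        c 0 :: List.ofFn fun j => c (i.succAbove j).succ := by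
      rw [List.ofFn_succ]; simp
    simp only [Fin.val_zero, Fin.val_succ, this]
    simp [pow_succ, sub_eq_add_neg]

end Cochains

section Kuhn

variable {G : Type*} [AddCommGroup G] {k : ℕ}

/-- The `j`-th vertex of the Kuhn simplex with edge directions `e (σ 0)`, `e (σ 1)`, … -/
def vertex (e : Fin k → G) (σ : Perm (Fin k)) (j : ℕ) : G :=
  ∑ m : Fin k with m.val < j, e (σ m)

/-- The signed sum of a function over all Kuhn simplices. -/
def kuhnSum [Fintype G] (e : Fin k → G) (F : (Fin (k + 1) → G) → ℤ) : ℤ :=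
  ∑ σ : Perm (Fin k), (Perm.sign σ : ℤ) * ∑ x : G, F fun j => x + vertex e σ j

theorem vertex_mul_swap (e : Fin (k + 1) → G) (σ : Perm (Fin (k + 1))) (i : Fin k) {j : ℕ}
    (hj : j ≠ i + 1) :
    vertex e (σ * swap i.castSucc i.succ) j = vertex e σ j := by
  unfold vertex
  refine Finset.sum_equiv (swap i.castSucc i.succ) (fun m => ?_) (fun m _ => rfl)
  simp only [mem_filter, mem_univ, true_and]
  rcases eq_or_ne m i.castSucc with rfl | h1
  · simp; omega
  rcases eq_or_ne m i.succ with rfl | h2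
  · simp; omega
  rw [swap_apply_of_ne_of_ne h1 h2]

theorem vertex_mul_finRotate (e : Fin (k + 1) → G) (σ : Perm (Fin (k + 1))) {j : ℕ}
    (hj : j ≤ k) :
    e (σ 0) + vertex e (σ * finRotate (k + 1)) j = vertex e σ (j + 1) := by
  unfold vertex
  simp only [Finset.sum_filter]
  rw [Fin.sum_univ_castSucc, Fin.sum_univ_succ (n := k)]
  simp [hj.not_gt, Fin.coeSucc_eq_succ]

/-- On a closed torus the signed sum of a coboundary over all Kuhn simplices vanishes. -/
theorem kuhnSum_coboundary [Fintype G] (e : Fin (k + 1) → G) (ψ : (Fin (k + 1) → G) → ℤ) :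
    kuhnSum e (fun c => ∑ i : Fin (k + 2), (-1) ^ (i : ℕ) * ψ fun j => c (i.succAbove j)) = 0 := by
  let T : Fin (k + 2) → ℤ := fun i => ∑ σ : Perm (Fin (k + 1)), (Perm.sign σ : ℤ) *
    ∑ x : G, ψ fun j => x + vertex e σ (i.succAbove j)
  have hT : kuhnSum e (fun c => ∑ i : Fin (k + 2), (-1) ^ (i : ℕ) * ψ fun j => c (i.succAbove j)) =
      ∑ i : Fin (k + 2), (-1) ^ (i : ℕ) * T i := by
    simp only [kuhnSum, T, mul_sum]
    symm
    rw [Finset.sum_comm]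
    refine sum_congr rfl fun σ _ => ?_
    rw [Finset.sum_comm]
    simp only [mul_left_comm]
  have hmid : ∀ i : Fin k, T i.castSucc.succ = 0 := by
    intro i
    have : T i.castSucc.succ = - T i.castSucc.succ := by
      conv_lhs => simp only [T]
      rw [← Equiv.sum_comp (Equiv.mulRight (swap i.castSucc i.succ))]
      simp only [T, ← Finset.sum_neg_distrib]
      refine sum_congr rfl fun σ _ => ?_
      have hne : i.castSucc ≠ i.succ := (Fin.castSucc_lt_succ).ne
      simp only [Equiv.coe_mulRight, Perm.sign_mul, Perm.sign_swap hne]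
      have : ∀ j : Fin (k + 1), vertex e (σ * swap i.castSucc i.succ)
          (i.castSucc.succ.succAbove j) = vertex e σ (i.castSucc.succ.succAbove j) := by
        intro j
        apply vertex_mul_swap
        have := Fin.succAbove_ne i.castSucc.succ j
        simpa [Fin.ext_iff] using this
      simp [this]
    linarith
  have hends : T (Fin.last (k + 1)) = (-1) ^ k * T 0 := by
    simp only [T]
    rw [← Equiv.sum_comp (Equiv.mulRight (finRotate (k + 1))), mul_sum]
    refine sum_congr rfl fun σ _ => ?_
    rw [← Equiv.sum_comp (Equiv.addRight (e (σ 0)))]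
    have : ∀ j : Fin (k + 1), e (σ 0) + vertex e (σ * finRotate (k + 1)) j =
        vertex e σ (j + 1) := fun j => vertex_mul_finRotate e σ (by omega)
    simp only [Equiv.coe_mulRight, Perm.sign_mul, sign_finRotate]
    simp only [Equiv.coe_addRight, add_assoc, Fin.succAbove_last, Fin.val_castSucc, this,
      Fin.zero_succAbove, Fin.val_succ, add_tsub_cancel_right, Units.val_mul, Units.val_pow_eq_pow_val,
      Units.val_neg, Units.val_one]
    ring
  rw [hT, Fin.sum_univ_succ, Fin.sum_univ_castSucc]
  simp [hends, hmid, pow_succ, ← mul_assoc, ← mul_pow]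

/-- Two labellings of the vertices of a torus have the same signed sum of a cochain if the
coboundary of the cochain vanishes on all simplices labelled by either of them inside a cell. -/
theorem kuhnSum_eq_of_coboundary_eq_zero {A : Type*} [Fintype G] (e : Fin (k + 1) → G)
    (L L' : G → A) (φ : List A → ℤ) (S : G → Set A)
    (hS : ∀ x σ j, L (x + vertex e σ j) ∈ S x ∧ L' (x + vertex e σ j) ∈ S x)
    (hφ : ∀ x, ∀ m : List A, m.length = k + 3 → (∀ a ∈ m, a ∈ S x) → coboundary m φ = 0) :
    kuhnSum e (fun c => φ (List.ofFn fun j => L (c j))) =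
      kuhnSum e (fun c => φ (List.ofFn fun j => L' (c j))) := by
  have h := kuhnSum_coboundary e
    (fun c => prism (List.ofFn fun j => (L (c j), L' (c j))) φ)
  rw [eq_comm, ← sub_eq_zero, ← h]
  simp only [kuhnSum, ← Finset.sum_sub_distrib, ← mul_sub]
  refine sum_congr rfl fun σ _ => congrArg _ (sum_congr rfl fun x _ => ?_)
  have h1 := prism_coboundary
    (List.ofFn fun j : Fin (k + 2) => (L (x + vertex e σ j), L' (x + vertex e σ j))) φ
  rw [prism_eq_zero (S x), zero_add, coboundary_ofFn] at h1
  · simpa [List.map_ofFn, Function.comp_def] using h1.symm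
  · simp only [List.mem_ofFn]
    rintro _ ⟨j, rfl⟩
    exact hS x σ j
  · intro m hm
    exact hφ x m (by simpa using hm)

end Kuhn

section Labels

variable {k : ℕ}

/-- The cochain on labels in `Fin (k + 2)` which detects, with sign, the tuples
containing all labels but the last one. -/
def labelDet (k : ℕ) (l : List (Fin (k + 2))) : ℤ :=
  (Matrix.of fun i j : Fin (k + 1) => if l[(i : ℕ)]? = some j.castSucc then (1 : ℤ) else 0).det

theorem labelDet_ofFn (c : Fin (k + 1) → Fin (k + 2)) :
    labelDet k (List.ofFn c) =
      (Matrix.of fun i j : Fin (k + 1) => if c i = j.castSucc then (1 : ℤ) else 0).det := by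
  simp [labelDet, -List.ofFn_succ, Fin.is_le]

theorem labelDet_ofFn_castSucc : labelDet k (List.ofFn Fin.castSucc) = 1 := by
  rw [labelDet_ofFn, ← Matrix.det_one (n := Fin (k + 1))]
  congr 1
  ext i j
  simp [Matrix.one_apply]

theorem labelDet_ofFn_eq_zero_of_eq (c : Fin (k + 1) → Fin (k + 2)) {i j : Fin (k + 1)}
    (hij : i ≠ j) (h : c i = c j) : labelDet k (List.ofFn c) = 0 := by
  rw [labelDet_ofFn]
  exact Matrix.det_zero_of_row_eq hij (by ext; simp [h])

theorem labelDet_ofFn_eq_zero_of_ne (c : Fin (k + 1) → Fin (k + 2)) (a : Fin (k + 1))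
    (h : ∀ i, c i ≠ a.castSucc) : labelDet k (List.ofFn c) = 0 := by
  rw [labelDet_ofFn]
  exact Matrix.det_eq_zero_of_column_eq_zero a (by simp [h])

theorem coboundary_labelDet_eq_zero (m : List (Fin (k + 2))) (hm : m.length = k + 2)
    (a : Fin (k + 2)) (ha : a ∉ m) : coboundary m (labelDet k) = 0 := by
  obtain ⟨c, rfl⟩ : ∃ c : Fin (k + 2) → Fin (k + 2), m = List.ofFn c :=
    ⟨fun i => m[i], by apply List.ext_getElem <;> simp [hm, -List.ofFn_succ]⟩
  have hc : ¬ Function.Injective c := fun h => ha <| by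
    obtain ⟨i, rfl⟩ := (Finite.injective_iff_surjective.1 h) a
    simp [-List.ofFn_succ]
  obtain ⟨i, j, hij, hne⟩ : ∃ i j, c i = c j ∧ i ≠ j := by
    simpa [Function.Injective] using hc
  let M : Matrix (Fin (k + 2)) (Fin (k + 2)) ℤ := Matrix.of fun i j =>
    Fin.cases 1 (fun j : Fin (k + 1) => if c i = j.castSucc then (1 : ℤ) else 0) j
  have hM : M.det = 0 := Matrix.det_zero_of_row_eq hne (by ext; simp [M, hij])
  rw [coboundary_ofFn, ← hM, Matrix.det_succ_column_zero]
  refine sum_congr rfl fun i _ => ?_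
  simp [labelDet_ofFn, M, Matrix.submatrix, -List.ofFn_succ]

end Labels

section SphereLabels

variable {k : ℕ}

open Classical in
/-- The label of a point of `ℝ^(k+1)` records the first negative coordinate. Points all of
whose coordinates are nonnegative have label `k`, and points whose only negative coordinate is
the last one have label `k + 1`. -/
noncomputable def label (x : Fin (k + 1) → ℝ) : Fin (k + 2) :=
  if h : ∃ i : Fin k, x i.castSucc < 0 then (Fin.find _ h).castSucc.castSucc
  else if x (Fin.last k) < 0 then Fin.last (k + 1) else (Fin.last k).castSucc

theorem label_eq_castSucc_castSucc {x : Fin (k + 1) → ℝ} {i : Fin k} :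
    label x = i.castSucc.castSucc ↔ x i.castSucc < 0 ∧ ∀ j < i, 0 ≤ x j.castSucc := by
  unfold label
  split_ifs with h h'
  · simp [Fin.find_eq_iff]
  · have h1 : Fin.last (k + 1) ≠ i.castSucc.castSucc := by
      simp [Fin.ext_iff]; omega
    simp only [h1, false_iff]
    exact fun h2 => h ⟨i, h2.1⟩
  · have h1 : (Fin.last k).castSucc ≠ i.castSucc.castSucc := by
      simp [Fin.ext_iff]; omega
    simp only [h1, false_iff]
    exact fun h2 => h ⟨i, h2.1⟩

theorem label_eq_castSucc_last {x : Fin (k + 1) → ℝ} :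
    label x = (Fin.last k).castSucc ↔ ∀ i, 0 ≤ x i := by
  unfold label
  split_ifs with h h'
  · have h1 : (Fin.find _ h).castSucc.castSucc ≠ (Fin.last k).castSucc := by
      simpa [Fin.ext_iff] using (Fin.find _ h).isLt.ne
    simp only [h1, false_iff]
    obtain ⟨i, hi⟩ := h
    exact fun h2 => (h2 _).not_gt hi
  · have h1 : Fin.last (k + 1) ≠ (Fin.last k).castSucc := by
      simp [Fin.ext_iff]
    simp only [h1, false_iff]
    exact fun h2 => (h2 _).not_gt h'
  · push Not at h h'
    simp only [true_iff]
    exact Fin.lastCases h' h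

theorem last_neg_of_label_eq_last {x : Fin (k + 1) → ℝ} (hx : label x = Fin.last (k + 1)) :
    x (Fin.last k) < 0 := by
  by_contra h'
  unfold label at hx
  split_ifs at hx with h
  · have := (Fin.find _ h).isLt
    simp only [Fin.ext_iff, Fin.val_castSucc, Fin.val_last] at hx
    omega
  · simp [Fin.ext_iff] at hx

/-- A set of unit vectors of small diameter does not carry all labels. -/
theorem exists_notMem_image_label (T : Set (EuclideanSpace ℝ (Fin (k + 1))))
    (hT : ∀ x ∈ T, ‖x‖ = 1) (hd : ∀ x ∈ T, ∀ y ∈ T, dist x y < 1 / (k + 1)) :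
    ∃ a : Fin (k + 2), ∀ x ∈ T, label x ≠ a := by
  by_contra! h
  obtain ⟨p, hp, hpl⟩ := h (Fin.last k).castSucc
  rw [label_eq_castSucc_last] at hpl
  have hlt (i : Fin (k + 1)) : p i < 1 / (k + 1) := by
    obtain ⟨y, hy, hyi⟩ : ∃ y ∈ T, y i < 0 := by
      induction i using Fin.lastCases with
      | last =>
        obtain ⟨y, hy, h⟩ := h (Fin.last (k + 1))
        exact ⟨y, hy, last_neg_of_label_eq_last h⟩
      | cast i =>
        obtain ⟨y, hy, h⟩ := h i.castSucc.castSucc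
        exact ⟨y, hy, (label_eq_castSucc_castSucc.1 h).1⟩
    have h1 : |p i - y i| ≤ dist p y := by
      rw [dist_eq_norm]
      simpa using PiLp.norm_apply_le (p - y) i
    have := hd p hp y hy
    have := le_abs_self (p i - y i)
    linarith
  have h1 : ∑ i, p i ^ 2 = 1 := by
    have := EuclideanSpace.norm_sq_eq p
    simpa [hT p hp] using this.symm
  have h2 : ∑ i, p i ^ 2 < ∑ i : Fin (k + 1), (1 / ((k : ℝ) + 1)) ^ 2 :=
    sum_lt_sum_of_nonempty univ_nonempty fun i _ => pow_lt_pow_left₀ (hlt i) (hpl i) two_ne_zero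
  rw [h1] at h2
  simp only [sum_const, card_univ, Fintype.card_fin, nsmul_eq_mul] at h2
  have h3 : (0 : ℝ) ≤ k := Nat.cast_nonneg k
  have h4 : ((k + 1 : ℕ) : ℝ) * (1 / ((k : ℝ) + 1)) ^ 2 = 1 / ((k : ℝ) + 1) := by
    push_cast; field_simp
  rw [h4, lt_div_iff₀ (by positivity)] at h2
  linarith

end SphereLabels

section Grid

variable {n : ℕ}

/-- The point of the unit interval with coordinate `a / P`. -/
noncomputable def tick (P a : ℕ) : unitInterval :=
  Set.projIcc 0 1 zero_le_one ((a : ℝ) / P)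

/-- The point of the unit cube with coordinates `a i / P`. -/
noncomputable def gridPoint (P : ℕ) (a : Fin n → ℕ) : Fin n → unitInterval :=
  fun i => tick P (a i)

theorem tick_zero (P : ℕ) : tick P 0 = 0 := by
  simp [tick]

theorem tick_self {P : ℕ} (hP : P ≠ 0) : tick P P = 1 := by
  simp [tick, hP]

theorem coe_tick {P a : ℕ} (h : a ≤ P) : (tick P a : ℝ) = a / P := by
  rw [tick, Set.projIcc_of_mem]
  exact ⟨by positivity, div_le_one_of_le₀ (by exact_mod_cast h) (by positivity)⟩

theorem dist_tick_le {P a b : ℕ} (h : a ≤ b + 1) (h' : b ≤ a + 1) :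
    dist (tick P a) (tick P b) ≤ 1 / P := by
  refine ((LipschitzWith.projIcc zero_le_one).dist_le_mul _ _).trans ?_
  rw [NNReal.coe_one, one_mul, Real.dist_eq, ← sub_div, abs_div, Nat.abs_cast]
  gcongr
  rw [abs_le]
  have h1 : (a : ℝ) ≤ b + 1 := by exact_mod_cast h
  have h2 : (b : ℝ) ≤ a + 1 := by exact_mod_cast h'
  constructor <;> linarith

/-- The point of the unit cube corresponding to a point of the discrete torus. -/
noncomputable def torusPoint {P : ℕ} (x : Fin n → ZMod P) : Fin n → unitInterval :=
  gridPoint P fun i => (x i).val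

/-- Whether the `j`-th vertex of a Kuhn simplex has moved in the direction `i`. -/
def step (σ : Perm (Fin n)) (j : ℕ) (i : Fin n) : ℕ :=
  if (σ.symm i).val < j then 1 else 0

theorem step_le_one (σ : Perm (Fin n)) (j : ℕ) (i : Fin n) : step σ j i ≤ 1 := by
  unfold step; split_ifs <;> simp

theorem vertex_single_apply (P : ℕ) (σ : Perm (Fin n)) (j : ℕ) (i : Fin n) :
    vertex (fun i => (Pi.single i 1 : Fin n → ZMod P)) σ j i = step σ j i := by
  simp only [vertex, Finset.sum_apply, step]
  rw [Finset.sum_filter, ← Equiv.sum_comp σ.symm, Finset.sum_eq_single i]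
  · simp
  · intro c _ hc
    simp [hc.symm]
  · simp

/-- A function on the cube which is constant on the boundary has the same value at a neighbour of
a point of the torus as at the corresponding neighbouring grid point. -/
theorem apply_torusPoint_add {X : Type*} {P : ℕ} [NeZero P] (f : (Fin n → unitInterval) → X) (b : X)
    (hf : ∀ y ∈ Cube.boundary (Fin n), f y = b) (x : Fin n → ZMod P) (v : Fin n → ℕ)
    (hv : ∀ i, v i ≤ 1) (y : Fin n → ZMod P) (hy : ∀ i, y i = x i + v i) :
    f (torusPoint y) = f (gridPoint P fun i => (x i).val + v i) := by
  by_cases h : ∀ i, (x i).val + v i < P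
  · congr 1
    unfold torusPoint
    congr 1
    funext i
    rw [hy, ← ZMod.val_cast_of_lt (h i)]
    simp
  · push Not at h
    obtain ⟨i, hi⟩ := h
    have h1 := ZMod.val_lt (x i)
    have h2 : (x i).val + v i = P := by have := hv i; omega
    rw [hf _ ⟨i, Or.inl ?_⟩, hf _ ⟨i, Or.inr ?_⟩]
    · simp only [gridPoint, h2]
      exact tick_self (NeZero.ne P)
    · have : y i = 0 := by
        rw [hy, ← ZMod.natCast_zmod_val (x i), ← Nat.cast_add, h2, ZMod.natCast_self]
      simp [torusPoint, gridPoint, this, tick_zero]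

end Grid

section Degree

variable {n : ℕ} {b : Metric.sphere (0 : EuclideanSpace ℝ (Fin (n + 2))) 1}

/-- The label of the image of a point of the torus. -/
noncomputable def torusLabel (R : ℕ)
    (f : (Fin (n + 1) → unitInterval) → Metric.sphere (0 : EuclideanSpace ℝ (Fin (n + 2))) 1)
    (x : Fin (n + 1) → ZMod (2 * R + 2)) : Fin (n + 3) :=
  label (f (torusPoint x)).1

/-- The combinatorial degree of a map from the cube to the sphere, computed on the grid with
`2 * R + 2` cells in each direction. -/
noncomputable def degree (R : ℕ)
    (f : (Fin (n + 1) → unitInterval) → Metric.sphere (0 : EuclideanSpace ℝ (Fin (n + 2))) 1) : ℤ :=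
  kuhnSum (fun i => (Pi.single i 1 : Fin (n + 1) → ZMod (2 * R + 2)))
    fun c => labelDet (n + 1) (List.ofFn fun j => torusLabel R f (c j))

theorem degree_eq_zero_of_label_ne (R : ℕ)
    (f : (Fin (n + 1) → unitInterval) → Metric.sphere (0 : EuclideanSpace ℝ (Fin (n + 2))) 1)
    (a : Fin (n + 2)) (h : ∀ y, label (f y).1 ≠ a.castSucc) : degree R f = 0 := by
  unfold degree kuhnSum
  refine sum_eq_zero fun σ _ => ?_
  rw [sum_eq_zero, mul_zero]
  intro x _
  exact labelDet_ofFn_eq_zero_of_ne _ a fun i => h _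

theorem torusLabel_add_vertex (R : ℕ)
    (f : (Fin (n + 1) → unitInterval) → Metric.sphere (0 : EuclideanSpace ℝ (Fin (n + 2))) 1)
    (hf : ∀ y ∈ Cube.boundary (Fin (n + 1)), f y = b) (x : Fin (n + 1) → ZMod (2 * R + 2))
    (σ : Perm (Fin (n + 1))) (j : ℕ) :
    torusLabel R f (x + vertex (fun i => (Pi.single i 1 : Fin (n + 1) → ZMod (2 * R + 2))) σ j) =
      label (f (gridPoint (2 * R + 2) fun i => (x i).val + step σ j i)).1 := by
  unfold torusLabel
  rw [apply_torusPoint_add f b hf x (step σ j) (step_le_one σ j)]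
  intro i
  rw [Pi.add_apply, vertex_single_apply]

open Filter in
/-- The combinatorial degree on sufficiently fine grids is a homotopy invariant. -/
theorem eventually_degree_eq_of_homotopic
    {f g : GenLoop (Fin (n + 1)) (Metric.sphere (0 : EuclideanSpace ℝ (Fin (n + 2))) 1) b}
    (h : GenLoop.Homotopic f g) : ∀ᶠ R in atTop, degree R f = degree R g := by
  obtain ⟨H⟩ := h
  have hH : UniformContinuous H := CompactSpace.uniformContinuous_of_continuous H.continuous
  obtain ⟨δ, hδ, hd⟩ := Metric.uniformContinuous_iff.1 hH (1 / ((n + 1 : ℕ) + 1)) (by positivity)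
  obtain ⟨N, hN⟩ := exists_nat_one_div_lt hδ
  filter_upwards [eventually_ge_atTop N] with R hR
  set P := 2 * R + 2 with hP
  have hPδ : (1 : ℝ) / P < δ := by
    refine lt_of_le_of_lt ?_ hN
    have : N + 1 ≤ P := by omega
    gcongr
    exact_mod_cast this
  let F (s : ℕ) (y : Fin (n + 1) → unitInterval) := H (tick P s, y)
  have hF (s : ℕ) : ∀ y ∈ Cube.boundary (Fin (n + 1)), F s y = b := fun y hy => by
    rw [← GenLoop.boundary f y hy]
    exact H.eq_fst _ hy
  have key (s : ℕ) : degree R (F s) = degree R (F (s + 1)) := by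
    let C (x : Fin (n + 1) → ZMod P) : Set (EuclideanSpace ℝ (Fin (n + 2))) :=
      {z | ∃ t, s ≤ t ∧ t ≤ s + 1 ∧ ∃ v : Fin (n + 1) → ℕ, (∀ i, v i ≤ 1) ∧
        z = (F t (gridPoint P fun i => (x i).val + v i)).1}
    refine kuhnSum_eq_of_coboundary_eq_zero _ _ _ _ (fun x => {a | ∃ z ∈ C x, label z = a}) ?_ ?_
    · intro x σ j
      rw [torusLabel_add_vertex R _ (hF s), torusLabel_add_vertex R _ (hF (s + 1))]
      exact ⟨⟨_, ⟨s, le_rfl, by simp, step σ j, step_le_one σ j, rfl⟩, rfl⟩,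
        ⟨_, ⟨s + 1, by simp, le_rfl, step σ j, step_le_one σ j, rfl⟩, rfl⟩⟩
    · intro x m hm hmS
      have h1 : ∀ z ∈ C x, ‖z‖ = 1 := by
        rintro _ ⟨t, -, -, v, -, rfl⟩
        simp
      have h2 : ∀ y ∈ C x, ∀ z ∈ C x, dist y z < 1 / ((n + 1 : ℕ) + 1) := by
        rintro _ ⟨t, ht, ht', v, hv, rfl⟩ _ ⟨u, hu, hu', w, hw, rfl⟩
        rw [← Subtype.dist_eq]
        refine hd (lt_of_le_of_lt ?_ hPδ)
        rw [Prod.dist_eq]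
        refine max_le (dist_tick_le (by omega) (by omega)) ?_
        rw [dist_pi_le_iff (by positivity)]
        intro i
        have := hv i
        have := hw i
        exact dist_tick_le (by dsimp only; omega) (by dsimp only; omega)
      obtain ⟨a, ha⟩ := exists_notMem_image_label (C x) h1 h2
      refine coboundary_labelDet_eq_zero m hm a fun h => ?_
      obtain ⟨z, hz, hza⟩ := hmS a h
      exact ha z hz hza
  have hall (s : ℕ) : degree R (F 0) = degree R (F s) := by
    induction s with
    | zero => rfl
    | succ s ih => rw [ih, key]
  have h0 : F 0 = f := by
    funext y
    simp only [F, tick_zero]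
    exact H.apply_zero y
  have h1 : F P = g := by
    funext y
    simp only [F, tick_self (show P ≠ 0 by omega)]
    exact H.apply_one y
  rw [← h0, ← h1, hall P]

theorem transAt_apply_of_le {X : Type*} [TopologicalSpace X] {c : X} {N : Type*} [DecidableEq N]
    (i : N) (f g : GenLoop N X c) {t : N → unitInterval} (h : (t i : ℝ) ≤ 1 / 2) :
    GenLoop.transAt i f g t =
      f (Function.update t i (Set.projIcc 0 1 zero_le_one (2 * t i))) := by
  rw [GenLoop.transAt, GenLoop.coe_copy, if_pos h]

theorem transAt_apply_of_ge {X : Type*} [TopologicalSpace X] {c : X} {N : Type*} [DecidableEq N]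
    (i : N) (f g : GenLoop N X c) {t : N → unitInterval} (h : 1 / 2 ≤ (t i : ℝ)) :
    GenLoop.transAt i f g t =
      g (Function.update t i (Set.projIcc 0 1 zero_le_one (2 * t i - 1))) := by
  rcases h.eq_or_lt with h | h
  · rw [transAt_apply_of_le i f g h.symm.le, GenLoop.boundary f _ ⟨i, Or.inr ?_⟩,
      GenLoop.boundary g _ ⟨i, Or.inl ?_⟩]
    · simp [← h]
    · simp [← h]
  · rw [GenLoop.transAt, GenLoop.coe_copy, if_neg h.not_ge]

theorem degree_transAt (R : ℕ) (i : Fin (n + 1))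
    (f g : GenLoop (Fin (n + 1)) (Metric.sphere (0 : EuclideanSpace ℝ (Fin (n + 2))) 1) b) :
    degree R (GenLoop.transAt i f g) =
      degree R (GenLoop.transAt i f GenLoop.const) +
        degree R (GenLoop.transAt i GenLoop.const g) := by
  simp only [degree, kuhnSum]
  simp only [← sum_add_distrib, ← mul_add]
  refine sum_congr rfl fun σ _ => congrArg _ (sum_congr rfl fun x _ => ?_)
  have hconst (a : Fin (n + 3)) : labelDet (n + 1) (List.ofFn fun _ => a) = 0 :=
    labelDet_ofFn_eq_zero_of_eq _ (i := 0) (j := 1) (by simp) rfl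
  simp only [torusLabel_add_vertex R _ (GenLoop.boundary _)]
  by_cases hx : (x i).val + 1 ≤ R + 1
  · have ht (j : ℕ) : ((gridPoint (2 * R + 2) fun i => (x i).val + step σ j i) i : ℝ) ≤ 1 / 2 := by
      have h1 : (x i).val + step σ j i ≤ R + 1 := by have := step_le_one σ j i; omega
      rw [gridPoint, coe_tick (by omega), div_le_iff₀ (by positivity)]
      have : (((x i).val + step σ j i : ℕ) : ℝ) ≤ (R + 1 : ℕ) := by exact_mod_cast h1
      push_cast at this ⊢
      linarith
    simp only [transAt_apply_of_le i _ _ (ht _), GenLoop.const_apply, hconst, add_zero]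
  · have ht (j : ℕ) : 1 / 2 ≤ ((gridPoint (2 * R + 2) fun i => (x i).val + step σ j i) i : ℝ) := by
      have h1 : R + 1 ≤ (x i).val + step σ j i := by omega
      have h2 := ZMod.val_lt (x i)
      rw [gridPoint, coe_tick (by have := step_le_one σ j i; omega), le_div_iff₀ (by positivity)]
      have : ((R + 1 : ℕ) : ℝ) ≤ ((x i).val + step σ j i : ℕ) := by exact_mod_cast h1
      push_cast at this ⊢
      linarith
    simp only [transAt_apply_of_ge i _ _ (ht _), GenLoop.const_apply, hconst, zero_add]

open Filter in
theorem eventually_degree_transAt (i : Fin (n + 1))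
    (f g : GenLoop (Fin (n + 1)) (Metric.sphere (0 : EuclideanSpace ℝ (Fin (n + 2))) 1) b) :
    ∀ᶠ R in atTop, degree R (GenLoop.transAt i f g) = degree R f + degree R g := by
  have hf : GenLoop.Homotopic (GenLoop.transAt i f GenLoop.const) f := Quotient.exact <|
    (HomotopyGroup.mul_spec (i := i) (p := GenLoop.const) (q := f)).symm.trans
      (one_mul (M := HomotopyGroup (Fin (n + 1)) _ b) ⟦f⟧)
  have hg : GenLoop.Homotopic (GenLoop.transAt i GenLoop.const g) g := Quotient.exact <|
    (HomotopyGroup.mul_spec (i := i) (p := g) (q := GenLoop.const)).symm.trans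
      (mul_one (M := HomotopyGroup (Fin (n + 1)) _ b) ⟦g⟧)
  filter_upwards [eventually_degree_eq_of_homotopic hf, eventually_degree_eq_of_homotopic hg]
    with R h1 h2
  rw [degree_transAt, h1, h2]

end Degree

section UnitVector

/-- The unit vector in the direction of a nonzero vector. -/
noncomputable def unitVector {E : Type*} [NormedAddCommGroup E] [NormedSpace ℝ E] (x : E)
    (hx : x ≠ 0) : Metric.sphere (0 : E) 1 :=
  ⟨‖x‖⁻¹ • x, by simp [norm_smul, hx]⟩

theorem continuous_unitVector {E X : Type*} [NormedAddCommGroup E] [NormedSpace ℝ E]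
    [TopologicalSpace X] {f : X → E} (hf : Continuous f) (h : ∀ x, f x ≠ 0) :
    Continuous fun x => unitVector (f x) (h x) :=
  ((hf.norm.inv₀ fun x => norm_ne_zero_iff.2 (h x)).smul hf).subtype_mk _

theorem label_congr {k : ℕ} {x y : Fin (k + 1) → ℝ} (h : ∀ i, x i < 0 ↔ y i < 0) :
    label x = label y := by
  unfold label
  simp only [h]

theorem label_unitVector {k : ℕ} (x : EuclideanSpace ℝ (Fin (k + 1))) (hx : x ≠ 0) :
    label (unitVector x hx).1 = label x := by
  refine label_congr fun i => ?_
  have : 0 < ‖x‖⁻¹ := inv_pos.2 (norm_pos_iff.2 hx)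
  simp [unitVector, mul_neg_iff, this, this.not_gt]

end UnitVector

section Collapse

variable {n : ℕ}

/-- The coordinates on the unit cube rescaled to the interval `[-1, 1]`. -/
noncomputable def centered (t : Fin (n + 1) → unitInterval) : Fin (n + 1) → ℝ :=
  fun i => 2 * t i - 1

theorem abs_centered_le (t : Fin (n + 1) → unitInterval) (i : Fin (n + 1)) :
    |centered t i| ≤ 1 := by
  have := (t i).2.1
  have := (t i).2.2
  rw [centered, abs_le]
  constructor <;> linarith

theorem norm_centered_le (t : Fin (n + 1) → unitInterval) : ‖centered t‖ ≤ 1 :=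
  (pi_norm_le_iff_of_nonneg zero_le_one).2 (abs_centered_le t)

theorem continuous_centered : Continuous (centered (n := n)) := by
  unfold centered
  fun_prop

/-- A map from the unit cube to Euclidean space which avoids the origin and is constant on the
boundary of the cube. -/
noncomputable def collapseVector (t : Fin (n + 1) → unitInterval) :
    EuclideanSpace ℝ (Fin (n + 2)) :=
  WithLp.toLp 2 (Fin.snoc (α := fun _ => ℝ) (fun i => (1 - ‖centered t‖) * centered t i)
    (1 - 2 * ‖centered t‖))

@[simp]
theorem collapseVector_castSucc (t : Fin (n + 1) → unitInterval) (i : Fin (n + 1)) :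
    collapseVector t i.castSucc = (1 - ‖centered t‖) * centered t i := by
  simp [collapseVector]

@[simp]
theorem collapseVector_last (t : Fin (n + 1) → unitInterval) :
    collapseVector t (Fin.last (n + 1)) = 1 - 2 * ‖centered t‖ := by
  simp [collapseVector]

theorem continuous_collapseVector : Continuous (collapseVector (n := n)) := by
  refine (PiLp.continuous_toLp 2 _).comp (continuous_pi fun i => ?_)
  have := continuous_centered (n := n)
  induction i using Fin.lastCases with
  | last =>
    simp only [Fin.snoc_last]
    fun_prop
  | cast i =>
    simp only [Fin.snoc_castSucc]
    fun_prop

theorem collapseVector_ne_zero (t : Fin (n + 1) → unitInterval) : collapseVector t ≠ 0 := by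
  intro h
  have h1 : 1 - 2 * ‖centered t‖ = 0 := by rw [← collapseVector_last, h]; rfl
  have h2 : centered t = 0 := by
    funext i
    have h3 : (1 - ‖centered t‖) * centered t i = 0 := by
      rw [← collapseVector_castSucc, h]; rfl
    rcases mul_eq_zero.1 h3 with h3 | h3
    · linarith
    · exact h3
  rw [h2, norm_zero] at h1
  norm_num at h1

theorem norm_centered_of_mem_boundary {t : Fin (n + 1) → unitInterval}
    (ht : t ∈ Cube.boundary (Fin (n + 1))) : ‖centered t‖ = 1 := by
  refine le_antisymm (norm_centered_le t) ?_
  obtain ⟨i, hi⟩ := ht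
  refine le_trans ?_ (norm_le_pi_norm (centered t) i)
  rcases hi with hi | hi <;> norm_num [centered, hi]

theorem collapseVector_of_mem_boundary {t : Fin (n + 1) → unitInterval}
    (ht : t ∈ Cube.boundary (Fin (n + 1))) :
    collapseVector t = -EuclideanSpace.single (Fin.last (n + 1)) 1 := by
  ext i
  induction i using Fin.lastCases with
  | last => norm_num [norm_centered_of_mem_boundary ht]
  | cast i => simp [norm_centered_of_mem_boundary ht, Fin.ext_iff, i.isLt.ne]

/-- The base point for the collapse map. -/
noncomputable def southPole (n : ℕ) : Metric.sphere (0 : EuclideanSpace ℝ (Fin (n + 2))) 1 :=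
  ⟨-EuclideanSpace.single (Fin.last (n + 1)) 1, by simp⟩

/-- A map of degree one from the cube relative to its boundary to the sphere. -/
noncomputable def collapse (n : ℕ) :
    GenLoop (Fin (n + 1)) (Metric.sphere (0 : EuclideanSpace ℝ (Fin (n + 2))) 1) (southPole n) :=
  ⟨⟨fun t => unitVector (collapseVector t) (collapseVector_ne_zero t),
    continuous_unitVector continuous_collapseVector _⟩, fun t ht => by
      apply Subtype.ext
      simp [unitVector, southPole, collapseVector_of_mem_boundary ht]⟩

theorem label_collapse (t : Fin (n + 1) → unitInterval) :
    label (collapse n t).1 = label (collapseVector t) :=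
  label_unitVector _ (collapseVector_ne_zero t)

theorem centered_gridPoint {R : ℕ} {a : Fin (n + 1) → ℕ} (i : Fin (n + 1))
    (ha : a i ≤ 2 * R + 2) :
    centered (gridPoint (2 * R + 2) a) i = ((a i : ℝ) - (R + 1)) / (R + 1) := by
  rw [centered, gridPoint, coe_tick ha]
  push_cast
  field_simp

theorem centered_gridPoint_neg_iff {R : ℕ} {a : Fin (n + 1) → ℕ} (i : Fin (n + 1))
    (ha : a i ≤ 2 * R + 2) : centered (gridPoint (2 * R + 2) a) i < 0 ↔ a i < R + 1 := by
  rw [centered_gridPoint i ha, div_lt_iff₀ (by positivity), zero_mul, sub_neg]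
  norm_cast

theorem label_collapse_eq_castSucc_castSucc {R : ℕ} {a : Fin (n + 1) → ℕ}
    (ha : ∀ i, a i ≤ 2 * R + 2) {i : Fin (n + 1)}
    (h : label (collapse n (gridPoint (2 * R + 2) a)).1 = i.castSucc.castSucc) :
    a i < R + 1 ∧ ∀ j < i, R + 1 ≤ a j := by
  rw [label_collapse, label_eq_castSucc_castSucc] at h
  simp only [collapseVector_castSucc] at h
  set t := gridPoint (2 * R + 2) a
  have h0 := norm_centered_le t
  have h1 : 0 < 1 - ‖centered t‖ := by
    rcases h0.eq_or_lt with h2 | h2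
    · simp [h2] at h
    · linarith
  refine ⟨?_, fun j hj => ?_⟩
  · rw [← centered_gridPoint_neg_iff i (ha i)]
    have := h.1
    by_contra! h3
    exact this.not_ge (mul_nonneg h1.le h3)
  · rw [← not_lt, ← centered_gridPoint_neg_iff j (ha j), not_lt]
    exact nonneg_of_mul_nonneg_right (h.2 j hj) h1

theorem label_collapse_eq_castSucc_last {R : ℕ} {a : Fin (n + 1) → ℕ}
    (ha : ∀ i, a i ≤ 2 * R + 2)
    (h : label (collapse n (gridPoint (2 * R + 2) a)).1 = (Fin.last (n + 1)).castSucc) :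
    ∀ i, R + 1 ≤ a i := by
  rw [label_collapse, label_eq_castSucc_last] at h
  set t := gridPoint (2 * R + 2) a
  have h0 := h (Fin.last (n + 1))
  rw [collapseVector_last] at h0
  intro i
  rw [← not_lt, ← centered_gridPoint_neg_iff i (ha i), not_lt]
  have := h i.castSucc
  rw [collapseVector_castSucc] at this
  exact nonneg_of_mul_nonneg_right this (by linarith)

theorem step_one_apply (j : ℕ) (i : Fin n) : step 1 j i = if i.val < j then 1 else 0 := rfl

theorem label_collapse_step {R : ℕ} (hR : 1 ≤ R) (j : Fin (n + 2)) :
    label (collapse n (gridPoint (2 * R + 2) fun i => R + step 1 j i)).1 = j.castSucc := by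
  have hs (i : Fin (n + 1)) : R + step 1 j i ≤ 2 * R + 2 := by
    have := step_le_one 1 j i; omega
  have hR' : (1 : ℝ) ≤ R := by exact_mod_cast hR
  have hnorm : ‖centered (gridPoint (2 * R + 2) fun i : Fin (n + 1) => R + step 1 j i)‖ ≤ 1 / 2 := by
    rw [pi_norm_le_iff_of_nonneg (by norm_num)]
    intro i
    rw [centered_gridPoint i (hs i), Real.norm_eq_abs, abs_le, le_div_iff₀ (by positivity),
      div_le_iff₀ (by positivity)]
    have h1 : ((step 1 j i : ℕ) : ℝ) ≤ 1 := by exact_mod_cast step_le_one 1 j i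
    have h2 : (0 : ℝ) ≤ (step 1 j i : ℕ) := by positivity
    push_cast
    constructor <;> linarith
  rw [label_collapse]
  induction j using Fin.lastCases with
  | last =>
    rw [label_eq_castSucc_last]
    intro i
    induction i using Fin.lastCases with
    | last => rw [collapseVector_last]; linarith
    | cast i =>
      rw [collapseVector_castSucc]
      refine mul_nonneg (by linarith) ?_
      rw [← not_lt, centered_gridPoint_neg_iff i (hs i)]
      simpa [step_one_apply] using Fin.is_le i
  | cast j =>
    rw [label_eq_castSucc_castSucc]
    simp only [collapseVector_castSucc]
    refine ⟨mul_neg_of_pos_of_neg (by linarith) ?_, fun i hi => mul_nonneg (by linarith) ?_⟩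
    · rw [centered_gridPoint_neg_iff j (hs j)]
      simp [step_one_apply]
    · rw [← not_lt, centered_gridPoint_neg_iff i (hs i)]
      simp [step_one_apply, hi]

theorem degree_collapse {R : ℕ} (hR : 1 ≤ R) : degree R (collapse n) = 1 := by
  simp only [degree, kuhnSum, torusLabel_add_vertex R _ (GenLoop.boundary (collapse n))]
  have hle (x : Fin (n + 1) → ZMod (2 * R + 2)) (σ : Perm (Fin (n + 1))) (j : ℕ)
      (i : Fin (n + 1)) : (x i).val + step σ j i ≤ 2 * R + 2 := by
    have := ZMod.val_lt (x i)
    have := step_le_one σ j i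
    omega
  have key (σ : Perm (Fin (n + 1))) (x : Fin (n + 1) → ZMod (2 * R + 2))
      (h : labelDet (n + 1) (List.ofFn fun j : Fin (n + 2) =>
        label (collapse n (gridPoint (2 * R + 2) fun i => (x i).val + step σ j i)).1) ≠ 0) :
      σ = 1 ∧ x = fun _ => (R : ZMod (2 * R + 2)) := by
    have hex (a : Fin (n + 2)) : ∃ j : Fin (n + 2),
        label (collapse n (gridPoint (2 * R + 2) fun i => (x i).val + step σ j i)).1 =
          a.castSucc := by
      by_contra! h'
      exact h (labelDet_ofFn_eq_zero_of_ne _ a h')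
    have hx (i : Fin (n + 1)) : (x i).val = R := by
      obtain ⟨j, hj⟩ := hex (Fin.last (n + 1))
      have h1 := label_collapse_eq_castSucc_last (hle x σ j) hj i
      obtain ⟨j', hj'⟩ := hex i.castSucc
      have h2 := (label_collapse_eq_castSucc_castSucc (hle x σ j') hj').1
      have := step_le_one σ j i
      omega
    constructor
    · have hmono : StrictMono σ.symm := by
        intro a b hab
        obtain ⟨j, hj⟩ := hex b.castSucc
        obtain ⟨h1, h2⟩ := label_collapse_eq_castSucc_castSucc (hle x σ j) hj
        have h3 := h2 a hab
        rw [hx] at h1 h3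
        simp only [step] at h1 h3
        rw [Fin.lt_def]
        split_ifs at h1 h3 <;> omega
      have h1 : σ.symm = 1 := by
        ext i
        rw [hmono.eq_id]
        rfl
      rw [← Equiv.symm_symm σ, h1]
      rfl
    · funext i
      rw [← ZMod.natCast_zmod_val (x i), hx]
  rw [sum_eq_single 1, sum_eq_single fun _ => (R : ZMod (2 * R + 2))]
  · have hv : (R : ZMod (2 * R + 2)).val = R := ZMod.val_cast_of_lt (by omega)
    simp only [hv, label_collapse_step hR]
    simpa using labelDet_ofFn_castSucc (k := n + 1)
  · intro x _ hx
    by_contra h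
    exact hx (key _ x h).2
  · simp
  · intro σ _ hσ
    rw [sum_eq_zero, mul_zero]
    intro x _
    by_contra h
    exact hσ (key σ x h).1
  · simp

end Collapse

section Lifting

variable {N X Y : Type*} [TopologicalSpace X] [TopologicalSpace Y]

/-- The composition of a generalized loop with a continuous map. -/
def mapLoop (p : C(X, Y)) {x : X} {y : Y} (h : p x = y) (f : GenLoop N X x) : GenLoop N Y y :=
  ⟨p.comp f.1, fun t ht => by
    rw [ContinuousMap.comp_apply, ← h]
    exact congrArg p (GenLoop.boundary f t ht)⟩

theorem mapLoop_apply (p : C(X, Y)) {x : X} {y : Y} (h : p x = y) (f : GenLoop N X x)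
    (t : N → unitInterval) : mapLoop p h f t = p (f t) := rfl

theorem mapLoop_const (p : C(X, Y)) {x : X} {y : Y} (h : p x = y) :
    mapLoop p h (GenLoop.const : GenLoop N X x) = GenLoop.const :=
  GenLoop.ext _ _ fun _ => h

theorem mapLoop_transAt [DecidableEq N] (p : C(X, Y)) {x : X} {y : Y} (h : p x = y) (i : N)
    (f g : GenLoop N X x) :
    mapLoop p h (GenLoop.transAt i f g) =
      GenLoop.transAt i (mapLoop p h f) (mapLoop p h g) := by
  refine GenLoop.ext _ _ fun t => ?_
  rw [mapLoop_apply]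
  rcases le_total (t i : ℝ) (1 / 2) with ht | ht
  · rw [transAt_apply_of_le i _ _ ht, transAt_apply_of_le i _ _ ht, mapLoop_apply]
  · rw [transAt_apply_of_ge i _ _ ht, transAt_apply_of_ge i _ _ ht, mapLoop_apply]

/-- Homotopies of generalized loops lift along a map with a continuous local transport of points
to nearby fibres. -/
theorem exists_homotopic_lift {N E B : Type*} [Finite N] [TopologicalSpace E] [MetricSpace B]
    (p : C(E, B)) {δ : ℝ} (hδ : 0 < δ) (T : {z : E × B // dist (p z.1) z.2 < δ} → E)
    (hT : Continuous T) (hpT : ∀ z, p (T z) = z.1.2)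
    (hTp : ∀ x (h : dist (p x) (p x) < δ), T ⟨(x, p x), h⟩ = x) {e : E} {b : B} (he : p e = b)
    (f : GenLoop N E e) (g : GenLoop N B b) (hfg : GenLoop.Homotopic (mapLoop p he f) g) :
    ∃ r : GenLoop N E e, GenLoop.Homotopic f r ∧ ∀ y, p (r y) = g y := by
  have := Fintype.ofFinite N
  obtain ⟨H⟩ := hfg
  have hH : UniformContinuous H := CompactSpace.uniformContinuous_of_continuous H.continuous
  obtain ⟨ε, hε, hd⟩ := Metric.uniformContinuous_iff.1 hH δ hδ
  obtain ⟨M, hM⟩ := exists_nat_one_div_lt hε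
  have hb (t : unitInterval) (y) (hy : y ∈ Cube.boundary N) : H (t, y) = p e := by
    exact (H.eq_fst _ hy).trans ((GenLoop.boundary (mapLoop p he f) y hy).trans he.symm)
  let c (s : ℕ) (t : unitInterval) : unitInterval :=
    Set.projIcc 0 1 zero_le_one ((s + (t : ℝ)) / ((M : ℝ) + 1))
  have hc (s : ℕ) : Continuous (c s) := by
    unfold c
    fun_prop
  have hc1 (s : ℕ) : c s 1 = c (s + 1) 0 := by simp [c]
  have hcd (s : ℕ) (t : unitInterval) : dist (c s 0) (c s t) < ε := by
    refine lt_of_le_of_lt ?_ hM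
    refine ((LipschitzWith.projIcc zero_le_one).dist_le_mul _ _).trans ?_
    rw [NNReal.coe_one, one_mul, Real.dist_eq, ← sub_div, abs_div,
      abs_of_pos (show (0 : ℝ) < M + 1 by positivity)]
    gcongr
    have := t.2.1
    have := t.2.2
    rw [abs_le]
    constructor <;> simp <;> linarith
  have key (s : ℕ) : ∃ r : GenLoop N E e, GenLoop.Homotopic f r ∧ ∀ y, p (r y) = H (c s 0, y) := by
    induction s with
    | zero =>
      refine ⟨f, GenLoop.Homotopic.refl f, fun y => ?_⟩
      have : c 0 0 = 0 := by simp [c]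
      rw [this]
      exact (H.apply_zero y).symm
    | succ s ih =>
      obtain ⟨r, hr, hpr⟩ := ih
      have hmem (z : unitInterval × (N → unitInterval)) :
          dist (p (r z.2)) (H (c s z.1, z.2)) < δ := by
        rw [hpr]
        refine hd ?_
        rw [Prod.dist_eq]
        simpa [hε] using hcd s z.1
      let K (z : unitInterval × (N → unitInterval)) : E :=
        T ⟨(r z.2, H (c s z.1, z.2)), hmem z⟩
      have hK : Continuous K := by
        refine hT.comp (Continuous.subtype_mk (Continuous.prodMk ?_ ?_) _)
        · exact r.1.continuous.comp continuous_snd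
        · exact H.continuous.comp (((hc s).comp continuous_fst).prodMk continuous_snd)
      have hK0 (t y) (h : H (c s t, y) = p (r y)) : K (t, y) = r y := by
        have := hmem (t, y)
        simp only [K]
        simp only [h] at this ⊢
        exact hTp _ _
      have hKb (t y) (hy : y ∈ Cube.boundary N) : K (t, y) = r y := by
        refine hK0 _ _ ?_
        rw [hb _ _ hy, GenLoop.boundary r y hy]
      let r' : GenLoop N E e := ⟨⟨fun y => K (1, y), hK.comp (by fun_prop)⟩, fun y hy =>
        (hKb 1 y hy).trans (GenLoop.boundary r y hy)⟩
      refine ⟨r', GenLoop.Homotopic.trans hr ⟨⟨⟨⟨K, hK⟩, ?_, ?_⟩, ?_⟩⟩, ?_⟩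
      · intro y
        exact hK0 0 y (hpr y).symm
      · intro y
        rfl
      · intro t y hy
        exact hKb t y hy
      · intro y
        rw [← hc1]
        exact hpT _
  obtain ⟨r, hr, hpr⟩ := key (M + 1)
  refine ⟨r, hr, fun y => ?_⟩
  have h1 : c (M + 1) 0 = 1 := by
    have : (M : ℝ) + 1 ≠ 0 := by positivity
    simp [c, this]
  rw [hpr, h1]
  exact H.apply_one y

end Lifting

section Hopf

/-- Clifford multiplication of the quaternionic plane `ℍ²` by a vector of `ℝ ⊕ ℍ`. -/
noncomputable def clifford (b : EuclideanSpace ℝ (Fin 5)) (x : EuclideanSpace ℝ (Fin 8)) :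
    EuclideanSpace ℝ (Fin 8) :=
  !₂[b 0 * x 0 + (b 1 * x 4 - b 2 * x 5 - b 3 * x 6 - b 4 * x 7),
    b 0 * x 1 + (b 1 * x 5 + b 2 * x 4 + b 3 * x 7 - b 4 * x 6),
    b 0 * x 2 + (b 1 * x 6 - b 2 * x 7 + b 3 * x 4 + b 4 * x 5),
    b 0 * x 3 + (b 1 * x 7 + b 2 * x 6 - b 3 * x 5 + b 4 * x 4),
    (b 1 * x 0 + b 2 * x 1 + b 3 * x 2 + b 4 * x 3) - b 0 * x 4,
    (b 1 * x 1 - b 2 * x 0 - b 3 * x 3 + b 4 * x 2) - b 0 * x 5,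
    (b 1 * x 2 + b 2 * x 3 - b 3 * x 0 - b 4 * x 1) - b 0 * x 6,
    (b 1 * x 3 - b 2 * x 2 + b 3 * x 1 - b 4 * x 0) - b 0 * x 7]

/-- The quadratic map `(u, v) ↦ (|u|² - |v|², 2 u (star v))` on `ℍ²`, which restricts to the Hopf map. -/
noncomputable def hopf (x : EuclideanSpace ℝ (Fin 8)) : EuclideanSpace ℝ (Fin 5) :=
  !₂[x 0 ^ 2 + x 1 ^ 2 + x 2 ^ 2 + x 3 ^ 2 - (x 4 ^ 2 + x 5 ^ 2 + x 6 ^ 2 + x 7 ^ 2),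
    2 * (x 0 * x 4 + x 1 * x 5 + x 2 * x 6 + x 3 * x 7),
    2 * (x 1 * x 4 - x 0 * x 5 - x 2 * x 7 + x 3 * x 6),
    2 * (x 2 * x 4 - x 0 * x 6 + x 1 * x 7 - x 3 * x 5),
    2 * (x 3 * x 4 - x 0 * x 7 - x 1 * x 6 + x 2 * x 5)]

theorem norm_sq_eight (x : EuclideanSpace ℝ (Fin 8)) :
    ‖x‖ ^ 2 = x 0 ^ 2 + x 1 ^ 2 + x 2 ^ 2 + x 3 ^ 2 + x 4 ^ 2 + x 5 ^ 2 + x 6 ^ 2 + x 7 ^ 2 := by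
  simp [EuclideanSpace.norm_sq_eq, Fin.sum_univ_eight]

theorem norm_sq_five (b : EuclideanSpace ℝ (Fin 5)) :
    ‖b‖ ^ 2 = b 0 ^ 2 + b 1 ^ 2 + b 2 ^ 2 + b 3 ^ 2 + b 4 ^ 2 := by
  simp [EuclideanSpace.norm_sq_eq, Fin.sum_univ_five]

theorem norm_hopf (x : EuclideanSpace ℝ (Fin 8)) : ‖hopf x‖ = ‖x‖ ^ 2 := by
  rw [← sq_eq_sq₀ (norm_nonneg _) (by positivity), norm_sq_five, norm_sq_eight]
  simp [hopf]
  ring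

theorem clifford_add (b : EuclideanSpace ℝ (Fin 5)) (x y : EuclideanSpace ℝ (Fin 8)) :
    clifford b (x + y) = clifford b x + clifford b y := by
  ext i
  fin_cases i <;> simp [clifford] <;> ring

theorem clifford_clifford (b : EuclideanSpace ℝ (Fin 5)) (x : EuclideanSpace ℝ (Fin 8)) :
    clifford b (clifford b x) = ‖b‖ ^ 2 • x := by
  rw [norm_sq_five]
  ext i
  fin_cases i <;> simp [clifford] <;> ring

theorem norm_sq_clifford (b : EuclideanSpace ℝ (Fin 5)) (x : EuclideanSpace ℝ (Fin 8)) :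
    ‖clifford b x‖ ^ 2 = ‖b‖ ^ 2 * ‖x‖ ^ 2 := by
  rw [norm_sq_five, norm_sq_eight, norm_sq_eight]
  simp [clifford]
  ring

theorem inner_clifford (b : EuclideanSpace ℝ (Fin 5)) (x : EuclideanSpace ℝ (Fin 8)) :
    inner ℝ x (clifford b x) = inner ℝ (hopf x) b := by
  simp [PiLp.inner_apply, Fin.sum_univ_eight, Fin.sum_univ_five, clifford, hopf]
  ring

theorem clifford_hopf (x : EuclideanSpace ℝ (Fin 8)) :
    clifford (hopf x) x = ‖x‖ ^ 2 • x := by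
  rw [norm_sq_eight]
  ext i
  fin_cases i <;> simp [clifford, hopf] <;> ring

theorem hopf_smul (c : ℝ) (x : EuclideanSpace ℝ (Fin 8)) : hopf (c • x) = c ^ 2 • hopf x := by
  ext i
  fin_cases i <;> simp [hopf] <;> ring

theorem continuous_hopf : Continuous hopf := by
  refine (PiLp.continuous_toLp 2 _).comp (continuous_pi fun i => ?_)
  fin_cases i <;> simp <;> fun_prop

theorem continuous_clifford :
    Continuous fun z : EuclideanSpace ℝ (Fin 5) × EuclideanSpace ℝ (Fin 8) =>
      clifford z.1 z.2 := by
  refine (PiLp.continuous_toLp 2 _).comp (continuous_pi fun i => ?_)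
  fin_cases i <;> simp <;> fun_prop

theorem hopf_eq_of_clifford_eq_self {b : EuclideanSpace ℝ (Fin 5)} (hb : ‖b‖ = 1)
    {y : EuclideanSpace ℝ (Fin 8)} (hy : clifford b y = y) : hopf y = ‖y‖ ^ 2 • b := by
  have h := inner_clifford b y
  rw [hy, real_inner_self_eq_norm_sq] at h
  rw [← sub_eq_zero, ← norm_eq_zero, ← sq_eq_zero_iff, norm_sub_sq_real, norm_hopf, norm_smul,
    inner_smul_right, ← h, hb, Real.norm_of_nonneg (by positivity)]
  ring

theorem add_clifford_ne_zero {b : EuclideanSpace ℝ (Fin 5)} (hb : ‖b‖ = 1)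
    {x : EuclideanSpace ℝ (Fin 8)} (hx : ‖x‖ = 1) (h : dist (hopf x) b < 2) :
    x + clifford b x ≠ 0 := by
  intro h0
  have h1 : ‖x + clifford b x‖ ^ 2 = 0 := by simp [h0]
  have h2 : dist (hopf x) b ^ 2 < 2 ^ 2 := pow_lt_pow_left₀ h dist_nonneg two_ne_zero
  rw [norm_add_sq_real, inner_clifford, norm_sq_clifford, hx, hb] at h1
  rw [dist_eq_norm, norm_sub_sq_real, norm_hopf, hx, hb] at h2
  linarith

theorem hopf_add_clifford {b : EuclideanSpace ℝ (Fin 5)} (hb : ‖b‖ = 1)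
    (x : EuclideanSpace ℝ (Fin 8)) (h : x + clifford b x ≠ 0) :
    hopf (unitVector _ h).1 = b := by
  have h1 := hopf_eq_of_clifford_eq_self hb (y := x + clifford b x) (by
    rw [clifford_add, clifford_clifford, hb, one_pow, one_smul, add_comm])
  have h2 : ‖x + clifford b x‖ ≠ 0 := norm_ne_zero_iff.2 h
  rw [unitVector, hopf_smul, h1, smul_smul, inv_pow, inv_mul_cancel₀ (pow_ne_zero 2 h2), one_smul]

theorem unitVector_add_clifford_hopf (x : Metric.sphere (0 : EuclideanSpace ℝ (Fin 8)) 1)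
    (h : x.1 + clifford (hopf x.1) x.1 ≠ 0) : unitVector _ h = x := by
  have hx : ‖x.1‖ = 1 := by simp
  apply Subtype.ext
  have h1 : x.1 + clifford (hopf x.1) x.1 = (2 : ℝ) • x.1 := by
    rw [clifford_hopf, hx, one_pow, one_smul, two_smul]
  simp only [unitVector, h1, norm_smul, hx, smul_smul]
  norm_num

/-- The Hopf map followed by an isometry. -/
noncomputable def hopfMap (A : EuclideanSpace ℝ (Fin 5) ≃ₗᵢ[ℝ] EuclideanSpace ℝ (Fin 5)) :
    C(Metric.sphere (0 : EuclideanSpace ℝ (Fin 8)) 1,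
      Metric.sphere (0 : EuclideanSpace ℝ (Fin 5)) 1) :=
  ⟨fun x => ⟨A (hopf x.1), by simp [norm_hopf]⟩,
    (A.continuous.comp (continuous_hopf.comp continuous_subtype_val)).subtype_mk _⟩

theorem exists_homotopic_lift_hopfMap
    (A : EuclideanSpace ℝ (Fin 5) ≃ₗᵢ[ℝ] EuclideanSpace ℝ (Fin 5)) {N : Type*} [Finite N]
    {e : Metric.sphere (0 : EuclideanSpace ℝ (Fin 8)) 1}
    {b : Metric.sphere (0 : EuclideanSpace ℝ (Fin 5)) 1} (he : hopfMap A e = b)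
    (f : GenLoop N (Metric.sphere (0 : EuclideanSpace ℝ (Fin 8)) 1) e)
    (g : GenLoop N (Metric.sphere (0 : EuclideanSpace ℝ (Fin 5)) 1) b)
    (hfg : GenLoop.Homotopic (mapLoop (hopfMap A) he f) g) :
    ∃ r : GenLoop N (Metric.sphere (0 : EuclideanSpace ℝ (Fin 8)) 1) e,
      GenLoop.Homotopic f r ∧ ∀ y, hopfMap A (r y) = g y := by
  have hne (z : {z : Metric.sphere (0 : EuclideanSpace ℝ (Fin 8)) 1 ×
      Metric.sphere (0 : EuclideanSpace ℝ (Fin 5)) 1 // dist (hopfMap A z.1) z.2 < 2}) :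
      z.1.1.1 + clifford (A.symm z.1.2.1) z.1.1.1 ≠ 0 := by
    refine add_clifford_ne_zero (by simp) (by simp) ?_
    have h := z.2
    rw [Subtype.dist_eq, ← A.symm.dist_map] at h
    simpa [hopfMap] using h
  refine exists_homotopic_lift (hopfMap A) two_pos (fun z => unitVector _ (hne z)) ?_ ?_ ?_ he f g
    hfg
  · refine continuous_unitVector ?_ hne
    have h1 : Continuous fun z : {z : Metric.sphere (0 : EuclideanSpace ℝ (Fin 8)) 1 ×
      Metric.sphere (0 : EuclideanSpace ℝ (Fin 5)) 1 // dist (hopfMap A z.1) z.2 < 2} =>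
        z.1.1.1 := by fun_prop
    have h2 : Continuous fun z : {z : Metric.sphere (0 : EuclideanSpace ℝ (Fin 8)) 1 ×
      Metric.sphere (0 : EuclideanSpace ℝ (Fin 5)) 1 // dist (hopfMap A z.1) z.2 < 2} =>
        A.symm z.1.2.1 := A.symm.continuous.comp (by fun_prop)
    exact h1.add (continuous_clifford.comp (h2.prodMk h1))
  · intro z
    apply Subtype.ext
    change A (hopf _) = _
    rw [hopf_add_clifford (by simp), A.apply_symm_apply]
  · intro x h
    have h1 : A.symm (hopfMap A x).1 = hopf x.1 := A.symm_apply_apply _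
    have h2 := hne ⟨(x, hopfMap A x), h⟩
    simp only [h1] at h2 ⊢
    exact unitVector_add_clifford_hopf x h2

theorem apply_zero_of_hopf_apply_zero {x : EuclideanSpace ℝ (Fin 8)} (hx : ‖x‖ = 1)
    (h : hopf x 0 = -1) : x 0 = 0 := by
  have h1 := norm_sq_eight x
  rw [hx] at h1
  simp only [hopf, PiLp.toLp_apply, Matrix.cons_val_zero] at h
  nlinarith [sq_nonneg (x 0), sq_nonneg (x 1), sq_nonneg (x 2), sq_nonneg (x 3)]

end Hopf

section Main

theorem degree_eq_zero_of_apply_zero (R : ℕ)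
    (f : (Fin 7 → unitInterval) → Metric.sphere (0 : EuclideanSpace ℝ (Fin 8)) 1)
    (h : ∀ y, (f y).1 0 = 0) : degree (n := 6) R f = 0 := by
  refine degree_eq_zero_of_label_ne (n := 6) R f (Fin.castSucc 0) fun y hy => ?_
  have h1 := (label_eq_castSucc_castSucc.1 hy).1
  exact h1.ne (h y)

theorem hopf_southPole : hopf (southPole 6).1 = EuclideanSpace.single 0 (-1) := by
  ext i
  fin_cases i <;> simp [hopf, southPole, Fin.ext_iff]

theorem exists_isometry_apply_eq {E : Type*} [NormedAddCommGroup E] [InnerProductSpace ℝ E]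
    {v w : E} (h : ‖v‖ = ‖w‖) : ∃ A : E ≃ₗᵢ[ℝ] E, A v = w :=
  ⟨_, Submodule.reflection_sub h⟩

/-- The class of a generalized loop in the homotopy group. -/
def homotopyClass {N X : Type*} [TopologicalSpace X] {x : X} (f : GenLoop N X x) :
    HomotopyGroup N X x := ⟦f⟧

theorem exists_mapLoop_eq_pow {x₀ : Metric.sphere (0 : EuclideanSpace ℝ (Fin 5)) 1}
    (p : C(Metric.sphere (0 : EuclideanSpace ℝ (Fin 8)) 1,
      Metric.sphere (0 : EuclideanSpace ℝ (Fin 5)) 1)) (hp : p (southPole 6) = x₀) (m : ℕ) :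
    ∃ q : GenLoop (Fin 7) (Metric.sphere (0 : EuclideanSpace ℝ (Fin 8)) 1) (southPole 6),
      homotopyClass (mapLoop p hp q) = homotopyClass (mapLoop p hp (collapse 6)) ^ m ∧
      ∀ᶠ R in Filter.atTop, degree (n := 6) R q = m := by
  induction m with
  | zero =>
    refine ⟨GenLoop.const, ?_, Filter.Eventually.of_forall fun R => ?_⟩
    · rw [mapLoop_const, pow_zero, HomotopyGroup.one_def]
      rfl
    · refine degree_eq_zero_of_apply_zero R _ fun y => ?_
      rw [GenLoop.const_apply]
      simp [southPole]
  | succ m ih =>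
    obtain ⟨q, hq, hd⟩ := ih
    refine ⟨GenLoop.transAt 0 (collapse 6) q, ?_, ?_⟩
    · rw [mapLoop_transAt, pow_succ, ← hq]
      exact (HomotopyGroup.mul_spec (i := (0 : Fin 7))).symm
    · filter_upwards [hd, eventually_degree_transAt (n := 6) 0 (collapse 6) q,
        Filter.eventually_ge_atTop 1] with R h1 h2 h3
      rw [h2, h1, degree_collapse h3]
      push_cast
      ring

end Main

end KuhnDegree

open KuhnDegree

/-- The seventh homotopy group of the 4-sphere contains an element of
infinite order. -/
theorem pi_seven_sphere_four_infinite_order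
    (x₀ : Metric.sphere (0 : EuclideanSpace ℝ (Fin 5)) 1) :
    ∃ g : HomotopyGroup (Fin 7) (Metric.sphere (0 : EuclideanSpace ℝ (Fin 5)) 1) x₀,
      ¬ IsOfFinOrder g := by
  obtain ⟨A, hA⟩ := exists_isometry_apply_eq
    (v := (EuclideanSpace.single 0 (-1) : EuclideanSpace ℝ (Fin 5))) (w := x₀.1) (by simp)
  have hp : hopfMap A (southPole 6) = x₀ := by
    apply Subtype.ext
    change A (hopf _) = _
    rw [hopf_southPole, hA]
  refine ⟨homotopyClass (mapLoop (hopfMap A) hp (collapse 6)), fun h => ?_⟩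
  obtain ⟨m, hm, hg⟩ := isOfFinOrder_iff_pow_eq_one.1 h
  obtain ⟨q, hq, hd⟩ := exists_mapLoop_eq_pow (hopfMap A) hp m
  rw [hg, HomotopyGroup.one_def] at hq
  obtain ⟨r, hr, hpr⟩ := exists_homotopic_lift_hopfMap A hp q _ (Quotient.exact hq)
  have h0 (R : ℕ) : degree (n := 6) R r = 0 := by
    refine degree_eq_zero_of_apply_zero R _ fun y => ?_
    refine apply_zero_of_hopf_apply_zero (by simp) ?_
    have h1 : A (hopf (r y).1) = x₀.1 := congrArg Subtype.val (hpr y)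
    rw [← hA] at h1
    rw [A.injective h1]
    simp
  obtain ⟨R, h1, h2⟩ := (hd.and (eventually_degree_eq_of_homotopic (n := 6) hr)).exists
  rw [h0, h1] at h2
  omega
end
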